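/- arXiv:1307.0746 — 3 statements merged into one kernel-verified Lean document; each statement's English description precedes it below -/
import Mathlib

section
/- Let N ≥ 2 and let f₁, f₂ : ℝ → [0,∞) be continuous, even, nondecreasing on [0,∞), with f₂(t) > 0 for t > 0, and satisfying: (1) there exist C > 0 and α < α_N with f₁(t) ≤ C Φ^α(t) for all t; (2) f₁(t)/f₂(t) → 0 as t → +∞; (3) liminf_{R→0⁺} [ R^N f̃₁(R) / ∫₀^R f̃₁(ρ) ρ^{N−1} dρ ] > 0, where f̃₁(R) := f₁( ω_{N−1}^{−1/N} (log(1/R))^{(N−1)/N} ). Then there exists a continuous ρ : B → (0,∞) (B the open unit ball of ℝ^N) such that sup { ∫_B f₁(u(x)) ρ(x)^{N/2} dx : u ∈ C_c^∞(B), ∫_B |∇u(x)|^N dx ≤ 1 } < +∞ while sup { ∫_B f₂(u(x)) ρ(x)^{N/2} dx : u ∈ C_c^∞(B), ∫_B |∇u(x)|^N dx ≤ 1 } = +∞. -/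
open MeasureTheory Real Filter

/-- `ω_{N-1}`, the `(N-1)`-dimensional measure of the unit sphere in `ℝ^N`. -/
noncomputable def sphereVol (N : ℕ) : ℝ :=
  N * Real.pi ^ ((N : ℝ) / 2) / Real.Gamma ((N : ℝ) / 2 + 1)

/-- `α_N := N ω_{N-1}^{1/(N-1)}`. -/
noncomputable def alphaMT (N : ℕ) : ℝ := N * sphereVol N ^ ((1 : ℝ) / ((N : ℝ) - 1))

/-- `Φ^α(t) := e^{α |t|^{N/(N-1)}} - ∑_{j=0}^{N-2} α^j |t|^{jN/(N-1)} / j!`. -/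
noncomputable def PhiGamma (N : ℕ) (α : ℝ) (t : ℝ) : ℝ :=
  Real.exp (α * |t| ^ ((N : ℝ) / ((N : ℝ) - 1))) -
    ∑ j ∈ Finset.range (N - 1),
      α ^ j * |t| ^ ((j : ℝ) * N / ((N : ℝ) - 1)) / (Nat.factorial j : ℝ)

/-- `f̃(R) := f(ω_{N-1}^{-1/N} (log(1/R))^{(N-1)/N})`. -/
noncomputable def ftilde (N : ℕ) (f : ℝ → ℝ) (R : ℝ) : ℝ :=
  f (sphereVol N ^ (-(1 : ℝ) / N) * Real.log (1 / R) ^ (((N : ℝ) - 1) / N))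

/-- The open unit ball of `ℝ^N`. -/
noncomputable def unitBall (N : ℕ) : Set (EuclideanSpace ℝ (Fin N)) := Metric.ball 0 1

/-- `u ∈ C_c^∞(Ω)`: smooth, compactly supported, with support contained in `Ω`. -/
def IsTest {N : ℕ} (Ω : Set (EuclideanSpace ℝ (Fin N)))
    (u : EuclideanSpace ℝ (Fin N) → ℝ) : Prop :=
  ContDiff ℝ (⊤ : ℕ∞) u ∧ HasCompactSupport u ∧ tsupport u ⊆ Ω



lemma sphereVol_pos (N : ℕ) (hN : 2 ≤ N) : 0 < sphereVol N := by
  unfold sphereVol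
  have : 0 < (N:ℝ) := by positivity
  have h2 : 0 < Real.Gamma ((N : ℝ) / 2 + 1) := Real.Gamma_pos_of_pos (by positivity)
  have := Real.pi_pos
  positivity

lemma toSphere_univ (N : ℕ) (hN : 2 ≤ N) :
    (volume : Measure (EuclideanSpace ℝ (Fin N))).toSphere Set.univ
      = ENNReal.ofReal (sphereVol N) := by
  have : Nonempty (Fin N) := ⟨⟨0, by omega⟩⟩
  rw [Measure.toSphere_apply_univ, EuclideanSpace.volume_ball]
  simp only [finrank_euclideanSpace, Fintype.card_fin, ENNReal.ofReal_one, one_pow, one_mul]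
  rw [← ENNReal.ofReal_natCast, ← ENNReal.ofReal_mul (by positivity)]
  congr 1
  unfold sphereVol
  rw [mul_div_assoc]
  congr 2
  rw [Real.sqrt_eq_rpow, ← Real.rpow_natCast, ← Real.rpow_mul Real.pi_pos.le]
  congr 1
  ring

lemma polar (N : ℕ) (hN : 2 ≤ N) (g : EuclideanSpace ℝ (Fin N) → ENNReal) (hg : Measurable g) :
    ∫⁻ y, g y = ∫⁻ θ, (∫⁻ t in Set.Ioi (0:ℝ), ENNReal.ofReal (t ^ (N-1)) * g (t • (θ : EuclideanSpace ℝ (Fin N))))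
      ∂(volume : Measure (EuclideanSpace ℝ (Fin N))).toSphere := by
  have : Nonempty (Fin N) := ⟨⟨0, by omega⟩⟩
  set μ := (volume : Measure (EuclideanSpace ℝ (Fin N)))
  have hmp := (μ.measurePreserving_homeomorphUnitSphereProd)
  have h1 : ∫⁻ y, g y ∂μ = ∫⁻ y : ({0}ᶜ : Set (EuclideanSpace ℝ (Fin N))), g y ∂(μ.comap (↑)) := by
    rw [lintegral_subtype_comap (measurableSet_singleton _).compl]
    rw [restrict_compl_singleton]
  have hG : Measurable (fun p : (Metric.sphere (0:EuclideanSpace ℝ (Fin N)) 1) × Set.Ioi (0:ℝ) => g (p.2.1 • p.1.1)) := by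
    apply hg.comp
    fun_prop
  have h2 : ∫⁻ y : ({0}ᶜ : Set (EuclideanSpace ℝ (Fin N))), g y ∂(μ.comap (↑)) =
     ∫⁻ p, g (p.2.1 • p.1.1) ∂(μ.toSphere.prod (Measure.volumeIoiPow (N - 1))) := by
    have e : Module.finrank ℝ (EuclideanSpace ℝ (Fin N)) = N := by simp
    rw [e] at hmp
    rw [← hmp.lintegral_comp hG]
    apply lintegral_congr
    intro y
    congr 1
    have hy : ‖(y : EuclideanSpace ℝ (Fin N))‖ ≠ 0 := by
      rw [norm_ne_zero_iff]
      exact y.2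
    simp [smul_smul, hy]
  rw [h1, h2, lintegral_prod _ hG.aemeasurable]
  apply lintegral_congr
  intro θ
  rw [Measure.volumeIoiPow, lintegral_withDensity_eq_lintegral_mul]
  · exact lintegral_subtype_comap measurableSet_Ioi (fun t : ℝ => ENNReal.ofReal (t ^ (N-1)) * g (t • (θ : EuclideanSpace ℝ (Fin N))))
  · fun_prop
  · apply hg.comp
    fun_prop

lemma polar_radial (N : ℕ) (hN : 2 ≤ N) (h : ℝ → ENNReal) (hh : Measurable h) :
    ∫⁻ y : EuclideanSpace ℝ (Fin N), h ‖y‖ =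
      ENNReal.ofReal (sphereVol N) * ∫⁻ t in Set.Ioi (0:ℝ), ENNReal.ofReal (t ^ (N-1)) * h t := by
  rw [polar N hN _ (by fun_prop), ← toSphere_univ N hN, mul_comm, ← lintegral_const]
  apply lintegral_congr
  intro θ
  apply setLIntegral_congr_fun measurableSet_Ioi
  intro t ht
  have ht : 0 < t := ht
  simp [norm_smul, abs_of_pos ht]

lemma fderiv_zero_of_not_mem {N : ℕ} {u : EuclideanSpace ℝ (Fin N) → ℝ} (hu : IsTest (unitBall N) u)
    (y : EuclideanSpace ℝ (Fin N)) (hy : 1 ≤ ‖y‖) : fderiv ℝ u y = 0 := by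
  by_contra h
  have h1 : y ∈ tsupport (fderiv ℝ u) := subset_tsupport _ h
  have h2 := hu.2.2 (tsupport_fderiv_subset ℝ h1)
  simp [unitBall] at h2
  linarith

lemma zero_of_not_mem {N : ℕ} {u : EuclideanSpace ℝ (Fin N) → ℝ} (hu : IsTest (unitBall N) u)
    (y : EuclideanSpace ℝ (Fin N)) (hy : 1 ≤ ‖y‖) : u y = 0 := by
  by_contra h
  have h1 : y ∈ tsupport u := subset_tsupport _ h
  have h2 := hu.2.2 h1
  simp [unitBall] at h2
  linarith

/-- representation by radial lines -/
lemma riesz_bound (N : ℕ) (hN : 2 ≤ N) {u : EuclideanSpace ℝ (Fin N) → ℝ} (hu : IsTest (unitBall N) u)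
    (x : EuclideanSpace ℝ (Fin N)) (hx : ‖x‖ < 1) :
    ENNReal.ofReal (sphereVol N) * ENNReal.ofReal |u x| ≤
      ∫⁻ y, ENNReal.ofReal (if ‖y‖ < 2 then (‖y‖ ^ (N-1))⁻¹ * ‖fderiv ℝ u (x + y)‖ else 0) := by
  have hcd : Continuous (fderiv ℝ u) := hu.1.continuous_fderiv (by simp)
  have hdiff : Differentiable ℝ u := hu.1.differentiable (by simp)
  have hmeas : Measurable (fun y => ENNReal.ofReal (if ‖y‖ < 2 then (‖y‖ ^ (N-1))⁻¹ * ‖fderiv ℝ u (x + y)‖ else 0)) := by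
    apply ENNReal.measurable_ofReal.comp
    apply Measurable.ite (measurableSet_lt (by fun_prop) (by fun_prop)) _ measurable_const
    apply Measurable.mul (by fun_prop)
    exact (hcd.comp (continuous_const.add continuous_id)).norm.measurable
  rw [polar N hN _ hmeas, ← toSphere_univ N hN, mul_comm, ← lintegral_const]
  apply lintegral_mono
  intro θ
  have hθ : ‖θ.1‖ = 1 := by simpa using θ.2
  set v : EuclideanSpace ℝ (Fin N) := θ.1 with hv
  have h0 : u (x + (2:ℝ) • v) = 0 := by
    apply zero_of_not_mem hu
    have h2 : ‖(2:ℝ) • v‖ = 2 := by simp [norm_smul, hθ]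
    have := norm_sub_norm_le ((2:ℝ) • v) (-x)
    rw [norm_neg, h2, sub_neg_eq_add, add_comm ((2:ℝ) • v)] at this
    linarith
  have hder : ∀ t ∈ Set.uIcc (0:ℝ) 2, HasDerivAt (fun t : ℝ => u (x + t • v)) (fderiv ℝ u (x + t • v) v) t := by
    intro t _
    have h1 : HasDerivAt (fun t : ℝ => x + t • v) v t := by
      simpa using ((hasDerivAt_id t).smul_const v).const_add x
    exact (hdiff (x + t • v)).hasFDerivAt.comp_hasDerivAt t h1
  have hcont : Continuous (fun t : ℝ => fderiv ℝ u (x + t • v) v) := by fun_prop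
  have hcont2 : Continuous (fun t : ℝ => ‖fderiv ℝ u (x + t • v)‖) := by fun_prop
  have hftc := intervalIntegral.integral_eq_sub_of_hasDerivAt hder (hcont.intervalIntegrable _ _)
  simp only [h0, zero_smul, add_zero, zero_sub] at hftc
  have hle : |u x| ≤ ∫ t in (0:ℝ)..2, ‖fderiv ℝ u (x + t • v)‖ := by
    rw [← abs_neg, ← hftc, ← Real.norm_eq_abs]
    refine (intervalIntegral.norm_integral_le_integral_norm (by norm_num)).trans ?_
    apply intervalIntegral.integral_mono_on (by norm_num) (hcont.norm.intervalIntegrable _ _) (hcont2.intervalIntegrable _ _)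
    intro t _
    have := (fderiv ℝ u (x + t • v)).le_opNorm v
    rwa [hθ, mul_one] at this
  calc ENNReal.ofReal |u x| ≤ ENNReal.ofReal (∫ t in (0:ℝ)..2, ‖fderiv ℝ u (x + t • v)‖) := ENNReal.ofReal_le_ofReal hle
    _ = ∫⁻ t in Set.Ioo (0:ℝ) 2, ENNReal.ofReal ‖fderiv ℝ u (x + t • v)‖ := by
        rw [intervalIntegral.integral_of_le (by norm_num), integral_Ioc_eq_integral_Ioo]
        rw [ofReal_integral_eq_lintegral_ofReal]
        · exact (hcont2.integrableOn_Icc (a := 0) (b := 2)).mono_set Set.Ioo_subset_Icc_self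
        · exact Eventually.of_forall (fun t => norm_nonneg _)
    _ ≤ ∫⁻ t in Set.Ioo (0:ℝ) 2, ENNReal.ofReal (t ^ (N-1)) * ENNReal.ofReal (if ‖t • v‖ < 2 then (‖t • v‖ ^ (N-1))⁻¹ * ‖fderiv ℝ u (x + t • v)‖ else 0) := by
        apply setLIntegral_mono' measurableSet_Ioo
        intro t ht
        have ht0 : 0 < t := ht.1
        have : ‖t • v‖ = t := by simp [norm_smul, hθ, abs_of_pos ht0]
        rw [this, if_pos ht.2, ← ENNReal.ofReal_mul (by positivity)]
        apply le_of_eq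
        congr 1
        field_simp
    _ ≤ _ := lintegral_mono_set Set.Ioo_subset_Ioi_self


lemma kernel_scalar (N : ℕ) (hN : 2 ≤ N) (τ δ t : ℝ) (hτ : 0 < τ) (hδ : 0 < δ) (ht : 0 < t) :
    ((t ^ (N-1))⁻¹ * (1 + δ ^ τ * t ^ (-τ)) ^ (-1 / (N:ℝ))) ^ ((N:ℝ) / ((N:ℝ) - 1)) ≤
      (t ^ N)⁻¹ * min 1 ((t / δ) ^ (τ / ((N:ℝ) - 1))) := by
  have hN1 : (2:ℝ) ≤ N := by exact_mod_cast hN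
  have hN2 : (0:ℝ) < (N:ℝ) - 1 := by linarith
  have hdt : 0 < δ ^ τ * t ^ (-τ) := by positivity
  set m := 1 + δ ^ τ * t ^ (-τ) with hm
  have hm1 : 1 ≤ m := by linarith
  rw [Real.mul_rpow (by positivity) (by positivity)]
  have e1 : ((t ^ (N-1))⁻¹) ^ ((N:ℝ) / ((N:ℝ) - 1)) = (t ^ N)⁻¹ := by
    rw [Real.inv_rpow (by positivity), ← Real.rpow_natCast t (N-1), ← Real.rpow_mul ht.le,
      Nat.cast_sub (by omega), Nat.cast_one, mul_div_cancel₀ _ hN2.ne', Real.rpow_natCast]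
  have e2 : (m ^ (-1 / (N:ℝ))) ^ ((N:ℝ) / ((N:ℝ) - 1)) = m ^ (-(1 / ((N:ℝ) - 1))) := by
    rw [← Real.rpow_mul (by linarith)]
    congr 1
    field_simp
  rw [e1, e2]
  gcongr
  apply le_min
  · apply Real.rpow_le_one_of_one_le_of_nonpos hm1
    have : 0 < 1 / ((N:ℝ) - 1) := by positivity
    linarith
  · calc m ^ (-(1 / ((N:ℝ) - 1))) ≤ (δ ^ τ * t ^ (-τ)) ^ (-(1 / ((N:ℝ) - 1))) := by
          apply Real.rpow_le_rpow_of_nonpos hdt (by linarith)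
          have : 0 < 1 / ((N:ℝ) - 1) := by positivity
          linarith
      _ = (t / δ) ^ (τ / ((N:ℝ) - 1)) := by
          rw [show δ ^ τ * t ^ (-τ) = (t/δ) ^ (-τ) by
            rw [Real.div_rpow ht.le hδ.le, Real.rpow_neg hδ.le, Real.rpow_neg ht.le]
            field_simp]
          rw [← Real.rpow_mul (by positivity)]
          congr 1
          field_simp

lemma kernel_radial (N : ℕ) (hN : 2 ≤ N) (β δ : ℝ) (hβ : 0 < β) (hδ : 0 < δ) (hδ1 : δ ≤ 1) :
    ∫⁻ t in Set.Ioi (0:ℝ), ENNReal.ofReal (t ^ (N-1)) *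
      ENNReal.ofReal (if t < 2 then (t ^ N)⁻¹ * min 1 ((t / δ) ^ β) else 0) ≤
      ENNReal.ofReal (1 / β + Real.log (2 / δ)) := by
  have hsplit : Set.Ioi (0:ℝ) = Set.Ioc 0 δ ∪ (Set.Ioc δ 2 ∪ Set.Ioi 2) := by
    rw [Set.Ioc_union_Ioi_eq_Ioi (by linarith), Set.Ioc_union_Ioi_eq_Ioi hδ.le]
  have hpt : ∀ t : ℝ, 0 < t → t ^ (N-1) * ((t ^ N)⁻¹ * min 1 ((t / δ) ^ β)) = t⁻¹ * min 1 ((t / δ) ^ β) := by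
    intro t ht
    rw [← mul_assoc]
    congr 1
    obtain ⟨k, rfl⟩ : ∃ k, N = k + 1 := ⟨N - 1, by omega⟩
    simp only [Nat.add_sub_cancel, pow_succ]
    field_simp
  have hlog : 0 ≤ Real.log (2 / δ) := Real.log_nonneg (by rw [le_div_iff₀ hδ]; linarith)
  rw [hsplit]
  refine (lintegral_union_le _ _ _).trans ?_
  rw [ENNReal.ofReal_add (by positivity) hlog]
  apply add_le_add
  · calc _ ≤ ∫⁻ t in Set.Ioc 0 δ, ENNReal.ofReal (δ ^ (-β) * t ^ (β - 1)) := by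
          apply setLIntegral_mono' measurableSet_Ioc
          intro t ht
          have ht0 : 0 < t := ht.1
          rw [if_pos (by linarith [ht.2]), ← ENNReal.ofReal_mul (by positivity), hpt t ht0]
          apply ENNReal.ofReal_le_ofReal
          calc t⁻¹ * min 1 ((t / δ) ^ β) ≤ t⁻¹ * (t / δ) ^ β := by
                gcongr
                exact min_le_right _ _
            _ = δ ^ (-β) * t ^ (β - 1) := by
                rw [Real.div_rpow ht0.le hδ.le, Real.rpow_neg hδ.le, Real.rpow_sub_one ht0.ne']
                field_simp
      _ = ENNReal.ofReal (∫ t in (0:ℝ)..δ, δ ^ (-β) * t ^ (β - 1)) := by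
          rw [intervalIntegral.integral_of_le hδ.le, ofReal_integral_eq_lintegral_ofReal]
          · have := (intervalIntegral.intervalIntegrable_rpow' (a := 0) (b := δ) (r := β - 1) (by linarith)).const_mul (δ ^ (-β))
            exact (intervalIntegrable_iff_integrableOn_Ioc_of_le hδ.le).1 this
          · filter_upwards [ae_restrict_mem measurableSet_Ioc] with t ht
            have ht0 : 0 < t := ht.1
            simp only [Pi.zero_apply]
            positivity
      _ ≤ _ := by
          apply ENNReal.ofReal_le_ofReal
          rw [intervalIntegral.integral_const_mul, integral_rpow (by left; linarith)]
          rw [sub_add_cancel, Real.zero_rpow hβ.ne', sub_zero, Real.rpow_neg hδ.le]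
          have : 0 < δ ^ β := by positivity
          apply le_of_eq
          field_simp
  · refine (lintegral_union_le _ _ _).trans ?_
    have hz : ∫⁻ t in Set.Ioi (2:ℝ), ENNReal.ofReal (t ^ (N-1)) *
      ENNReal.ofReal (if t < 2 then (t ^ N)⁻¹ * min 1 ((t / δ) ^ β) else 0) = 0 := by
      rw [setLIntegral_congr_fun (g := fun _ => 0) measurableSet_Ioi]
      · simp
      · intro t ht
        have ht : 2 < t := ht
        simp [not_lt.2 ht.le]
    rw [hz, add_zero]
    calc _ ≤ ∫⁻ t in Set.Ioc δ 2, ENNReal.ofReal (t⁻¹) := by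
          apply setLIntegral_mono' measurableSet_Ioc
          intro t ht
          have ht0 : 0 < t := hδ.trans ht.1
          split_ifs
          · rw [← ENNReal.ofReal_mul (by positivity), hpt t ht0]
            apply ENNReal.ofReal_le_ofReal
            exact mul_le_of_le_one_right (by positivity) (min_le_left _ _)
          · simp
      _ = ENNReal.ofReal (∫ t in δ..2, t⁻¹) := by
          rw [intervalIntegral.integral_of_le (by linarith), ofReal_integral_eq_lintegral_ofReal]
          · have : IntervalIntegrable (fun t : ℝ => t⁻¹) volume δ 2 := by
              apply ContinuousOn.intervalIntegrable
              apply ContinuousOn.inv₀ continuousOn_id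
              intro t ht
              rw [Set.uIcc_of_le (by linarith)] at ht
              simp only [id]
              linarith [ht.1]
            exact (intervalIntegrable_iff_integrableOn_Ioc_of_le (by linarith)).1 this
          · filter_upwards [ae_restrict_mem measurableSet_Ioc] with t ht
            have ht0 : 0 < t := hδ.trans ht.1
            simp only [Pi.zero_apply]
            positivity
      _ = _ := by rw [integral_inv_of_pos hδ (by norm_num)]

lemma riesz_radial (N : ℕ) (hN : 2 ≤ N) (τ : ℝ) (hτN : τ < N) :
    ∫⁻ t in Set.Ioi (0:ℝ), ENNReal.ofReal (t ^ (N-1)) *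
      ENNReal.ofReal (if t < 2 then t ^ (-τ) else 0) ≠ ⊤ := by
  apply ne_of_lt
  have h := (intervalIntegral.intervalIntegrable_rpow' (a := 0) (b := 2) (r := (N:ℝ) - 1 - τ) (by linarith))
  have h' := (intervalIntegrable_iff_integrableOn_Ioc_of_le (by norm_num)).1 h
  calc _ ≤ ∫⁻ t in Set.Ioc (0:ℝ) 2 ∪ Set.Ioi 2, ENNReal.ofReal (t ^ (N-1)) *
      ENNReal.ofReal (if t < 2 then t ^ (-τ) else 0) := by
        rw [Set.Ioc_union_Ioi_eq_Ioi (by norm_num)]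
    _ ≤ _ := lintegral_union_le _ _ _
    _ ≤ (∫⁻ t in Set.Ioc (0:ℝ) 2, ‖t ^ ((N:ℝ) - 1 - τ)‖ₑ) + 0 := by
        apply add_le_add
        · apply setLIntegral_mono' measurableSet_Ioc
          intro t ht
          have ht0 : 0 < t := ht.1
          split_ifs
          · rw [← ENNReal.ofReal_mul (by positivity), Real.enorm_eq_ofReal (by positivity)]
            apply le_of_eq
            congr 1
            rw [← Real.rpow_natCast t (N-1), ← Real.rpow_add ht0, Nat.cast_sub (by omega), Nat.cast_one, sub_eq_add_neg _ τ]
          · simp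
        · apply le_of_eq
          rw [setLIntegral_congr_fun (g := fun _ => 0) measurableSet_Ioi]
          · simp
          · intro t ht
            have ht : 2 < t := ht
            simp [not_lt.2 ht.le]
    _ < ⊤ := by
        rw [add_zero]
        exact h'.2

/-- the auxiliary potential -/
noncomputable def GPot (N : ℕ) (τ : ℝ) (u : EuclideanSpace ℝ (Fin N) → ℝ) (x : EuclideanSpace ℝ (Fin N)) : ENNReal :=
  ∫⁻ y : EuclideanSpace ℝ (Fin N), ENNReal.ofReal (if ‖y‖ < 2 then ‖y‖ ^ (-τ) else 0) * ENNReal.ofReal (‖fderiv ℝ u (x + y)‖ ^ N)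

lemma energy_lintegral (N : ℕ) (hN : 2 ≤ N) {u : EuclideanSpace ℝ (Fin N) → ℝ} (hu : IsTest (unitBall N) u)
    (hE : (∫ x in unitBall N, ‖fderiv ℝ u x‖ ^ N) ≤ 1) :
    ∫⁻ y, ENNReal.ofReal (‖fderiv ℝ u y‖ ^ N) ≤ 1 := by
  have hcd : Continuous (fderiv ℝ u) := hu.1.continuous_fderiv (by simp)
  have hInt0 : Integrable (fun y => ‖fderiv ℝ u y‖ ^ N) := by
    apply Continuous.integrable_of_hasCompactSupport (by fun_prop)
    have := (hu.2.1.fderiv (𝕜 := ℝ)).norm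
    exact this.comp_left (g := fun t : ℝ => t ^ N) (by simp; omega)
  rw [← ofReal_integral_eq_lintegral_ofReal hInt0 (Eventually.of_forall fun y => by positivity)]
  rw [← setIntegral_eq_integral_of_forall_compl_eq_zero (s := unitBall N)]
  · exact ENNReal.ofReal_le_one.2 hE
  · intro y hy
    rw [fderiv_zero_of_not_mem hu y (by simpa [unitBall] using hy)]
    simp
    omega

lemma lintegral_GPot (N : ℕ) (hN : 2 ≤ N) (τ : ℝ) (hτN : τ < N) :
    ∃ A : ENNReal, A ≠ ⊤ ∧ ∀ u : EuclideanSpace ℝ (Fin N) → ℝ, IsTest (unitBall N) u →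
      (∫ x in unitBall N, ‖fderiv ℝ u x‖ ^ N) ≤ 1 → Measurable (GPot N τ u) ∧ ∫⁻ x, GPot N τ u x ≤ A := by
  set h : ℝ → ENNReal := fun t => ENNReal.ofReal (if t < 2 then t ^ (-τ) else 0) with hh
  have hm : Measurable h := by
    apply ENNReal.measurable_ofReal.comp
    exact Measurable.ite (measurableSet_lt (by fun_prop) (by fun_prop)) (by fun_prop) measurable_const
  refine ⟨_, ENNReal.mul_ne_top (ENNReal.ofReal_ne_top (r := sphereVol N)) (riesz_radial N hN τ hτN) , ?_⟩
  intro u hu hE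
  have hcd : Continuous (fderiv ℝ u) := hu.1.continuous_fderiv (by simp)
  have hfm : Measurable (fun y => ENNReal.ofReal (‖fderiv ℝ u y‖ ^ N)) := by
    apply ENNReal.measurable_ofReal.comp
    exact (hcd.norm.pow N).measurable
  have hjoint : Measurable (Function.uncurry fun (x y : EuclideanSpace ℝ (Fin N)) => h ‖y‖ * ENNReal.ofReal (‖fderiv ℝ u (x + y)‖ ^ N)) := by
    have e1 : Measurable (fun q : EuclideanSpace ℝ (Fin N) × EuclideanSpace ℝ (Fin N) => h ‖q.2‖) :=
      hm.comp (measurable_snd.norm)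
    have e2 : Measurable (fun q : EuclideanSpace ℝ (Fin N) × EuclideanSpace ℝ (Fin N) =>
        ENNReal.ofReal (‖fderiv ℝ u (q.1 + q.2)‖ ^ N)) := hfm.comp (measurable_fst.add measurable_snd)
    exact e1.mul e2
  constructor
  · exact hjoint.lintegral_prod_right'
  unfold GPot
  rw [lintegral_lintegral_swap hjoint.aemeasurable, ← polar_radial N hN h hm]
  apply lintegral_mono
  intro y
  show ∫⁻ x, h ‖y‖ * ENNReal.ofReal (‖fderiv ℝ u (x + y)‖ ^ N) ≤ h ‖y‖
  rw [lintegral_const_mul' _ _ ENNReal.ofReal_ne_top]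
  apply mul_le_of_le_one_right zero_le
  rw [lintegral_add_right_eq_self (fun x => ENNReal.ofReal (‖fderiv ℝ u x‖ ^ N))]
  exact energy_lintegral N hN hu hE


lemma holder_bound (N : ℕ) (hN : 2 ≤ N) (τ δ η : ℝ) (hτ : 0 < τ) (hδ : 0 < δ) (hδ1 : δ ≤ 1)
    (hη : 0 ≤ η) {u : EuclideanSpace ℝ (Fin N) → ℝ} (hu : IsTest (unitBall N) u)
    (hE : (∫ x in unitBall N, ‖fderiv ℝ u x‖ ^ N) ≤ 1)
    (x : EuclideanSpace ℝ (Fin N)) (hx : ‖x‖ < 1)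
    (hG : ENNReal.ofReal (δ ^ τ) * GPot N τ u x ≤ ENNReal.ofReal η) :
    |u x| ^ ((N:ℝ) / ((N:ℝ) - 1)) ≤
      (1 + η) * (sphereVol N ^ (-(1 / ((N:ℝ) - 1))) * (((N:ℝ) - 1) / τ + Real.log (2 / δ))) := by
  have hN1 : (2:ℝ) ≤ N := by exact_mod_cast hN
  have hN2 : (0:ℝ) < (N:ℝ) - 1 := by linarith
  have hω := sphereVol_pos N hN
  set ω := sphereVol N with hωdef
  set p : ℝ := (N:ℝ) / ((N:ℝ) - 1) with hp
  have hp0 : 0 < p := by positivity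
  have hpq : p.HolderConjugate N := by
    rw [Real.holderConjugate_iff]
    constructor
    · rw [hp, lt_div_iff₀ hN2]; linarith
    · rw [hp]; field_simp; ring
  have hcd : Continuous (fderiv ℝ u) := hu.1.continuous_fderiv (by simp)
  set m : EuclideanSpace ℝ (Fin N) → ℝ := fun y => 1 + δ ^ τ * ‖y‖ ^ (-τ) with hm
  have hm0 : ∀ y, 0 < m y := fun y => by simp only [hm]; positivity
  have hmm : Measurable m := by
    simp only [hm]
    fun_prop
  set F : EuclideanSpace ℝ (Fin N) → ℝ := fun y => ‖fderiv ℝ u (x + y)‖ with hF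
  have hF0 : ∀ y, 0 ≤ F y := fun y => norm_nonneg _
  have hFm : Measurable F := (hcd.comp (continuous_const.add continuous_id)).norm.measurable
  have hset : MeasurableSet {y : EuclideanSpace ℝ (Fin N) | ‖y‖ < 2} := measurableSet_lt (by fun_prop) (by fun_prop)
  set a : EuclideanSpace ℝ (Fin N) → ENNReal := fun y => ENNReal.ofReal (if ‖y‖ < 2 then (‖y‖ ^ (N-1))⁻¹ * (m y) ^ (-1 / (N:ℝ)) else 0) with ha
  set b : EuclideanSpace ℝ (Fin N) → ENNReal := fun y => ENNReal.ofReal (if ‖y‖ < 2 then (m y) ^ (1 / (N:ℝ)) * F y else 0) with hb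
  have ham : Measurable a := by
    apply ENNReal.measurable_ofReal.comp
    exact Measurable.ite hset (by fun_prop) measurable_const
  have hbm : Measurable b := by
    apply ENNReal.measurable_ofReal.comp
    exact Measurable.ite hset (by fun_prop) measurable_const
  have hA : ∫⁻ y, a y ^ p ≤ ENNReal.ofReal (ω * (((N:ℝ) - 1) / τ + Real.log (2 / δ))) := by
    set h : ℝ → ENNReal := fun t => ENNReal.ofReal (if t < 2 then (t ^ N)⁻¹ * min 1 ((t / δ) ^ (τ / ((N:ℝ) - 1))) else 0) with hh
    have hhm : Measurable h := by
      apply ENNReal.measurable_ofReal.comp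
      exact Measurable.ite (measurableSet_lt (by fun_prop) (by fun_prop)) (by fun_prop) measurable_const
    calc ∫⁻ y, a y ^ p ≤ ∫⁻ y : EuclideanSpace ℝ (Fin N), h ‖y‖ := by
          apply lintegral_mono
          intro y
          simp only [ha, hh]
          split_ifs with h2
          · rw [ENNReal.ofReal_rpow_of_nonneg (by have := hm0 y; positivity) hp0.le]
            apply ENNReal.ofReal_le_ofReal
            rcases (norm_nonneg y).eq_or_lt with h0 | h0
            · rw [← h0, zero_pow (by omega), zero_pow (by omega)]
              simp [Real.zero_rpow hp0.ne']
            · exact kernel_scalar N hN τ δ ‖y‖ hτ hδ h0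
          · simp [hp0]
      _ = _ := polar_radial N hN h hhm
      _ ≤ ENNReal.ofReal ω * ENNReal.ofReal (1 / (τ / ((N:ℝ) - 1)) + Real.log (2 / δ)) := by
          gcongr
          exact kernel_radial N hN _ δ (by positivity) hδ hδ1
      _ = _ := by rw [← ENNReal.ofReal_mul hω.le, one_div_div]
  have hB : ∫⁻ y, b y ^ (N:ℝ) ≤ ENNReal.ofReal (1 + η) := by
    calc ∫⁻ y, b y ^ (N:ℝ) ≤ ∫⁻ y, (ENNReal.ofReal (F y ^ N) + ENNReal.ofReal (δ ^ τ) * (ENNReal.ofReal (if ‖y‖ < 2 then ‖y‖ ^ (-τ) else 0) * ENNReal.ofReal (F y ^ N))) := by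
          apply lintegral_mono
          intro y
          simp only [hb]
          split_ifs with h2
          · have := hF0 y
            have := hm0 y
            rw [ENNReal.ofReal_rpow_of_nonneg (by positivity) (by positivity),
              Real.mul_rpow (by positivity) (by positivity), ← Real.rpow_mul (by positivity),
              one_div_mul_cancel (by positivity), Real.rpow_one, Real.rpow_natCast,
              ← ENNReal.ofReal_mul (by positivity), ← ENNReal.ofReal_mul (by positivity),
              ← ENNReal.ofReal_add (by positivity) (by positivity)]
            apply ENNReal.ofReal_le_ofReal
            simp only [hm]
            apply le_of_eq
            ring
          · rw [ENNReal.ofReal_zero, ENNReal.zero_rpow_of_pos (by positivity)]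
            exact zero_le
      _ = (∫⁻ y, ENNReal.ofReal (F y ^ N)) + ENNReal.ofReal (δ ^ τ) * GPot N τ u x := by
          rw [lintegral_add_left (by fun_prop), lintegral_const_mul']
          · rfl
          · exact ENNReal.ofReal_ne_top
      _ ≤ 1 + ENNReal.ofReal η := by
          gcongr
          have := lintegral_add_left_eq_self (μ := volume) (fun y => ENNReal.ofReal (‖fderiv ℝ u y‖ ^ N)) x
          simp only [hF]
          rw [this]
          exact energy_lintegral N hN hu hE
      _ = _ := by rw [ENNReal.ofReal_add zero_le_one hη, ENNReal.ofReal_one]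
  have hlog : 0 ≤ Real.log (2 / δ) := Real.log_nonneg (by rw [le_div_iff₀ hδ]; linarith)
  set K := ((N:ℝ) - 1) / τ + Real.log (2 / δ) with hK
  have hK0 : 0 < K := by positivity
  have hmain : ENNReal.ofReal (ω * |u x|) ≤ ENNReal.ofReal ((ω * K) ^ (1/p) * (1 + η) ^ (1/(N:ℝ))) := by
    calc ENNReal.ofReal (ω * |u x|) = ENNReal.ofReal ω * ENNReal.ofReal |u x| := ENNReal.ofReal_mul hω.le
      _ ≤ _ := riesz_bound N hN hu x hx
      _ ≤ ∫⁻ y, (a * b) y := by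
          apply lintegral_mono
          intro y
          simp only [Pi.mul_apply, ha, hb]
          split_ifs with h2
          · have := hF0 y
            have := hm0 y
            rw [← ENNReal.ofReal_mul (by positivity)]
            apply ENNReal.ofReal_le_ofReal
            apply le_of_eq
            have e : (m y) ^ (-1 / (N:ℝ)) * (m y) ^ (1 / (N:ℝ)) = 1 := by
              rw [← Real.rpow_add this, ← add_div, neg_add_cancel, zero_div, Real.rpow_zero]
            calc (‖y‖ ^ (N-1))⁻¹ * ‖fderiv ℝ u (x + y)‖ = (‖y‖ ^ (N-1))⁻¹ * (((m y) ^ (-1 / (N:ℝ)) * (m y) ^ (1 / (N:ℝ))) * F y) := by rw [e, one_mul]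
              _ = _ := by ring
          · simp
      _ ≤ _ := ENNReal.lintegral_mul_le_Lp_mul_Lq volume hpq ham.aemeasurable hbm.aemeasurable
      _ ≤ (ENNReal.ofReal (ω * K)) ^ (1/p) * (ENNReal.ofReal (1 + η)) ^ (1/(N:ℝ)) := by
          gcongr
      _ = _ := by
          rw [ENNReal.ofReal_rpow_of_nonneg (by positivity) (by positivity), ENNReal.ofReal_rpow_of_nonneg (by positivity) (by positivity), ← ENNReal.ofReal_mul (by positivity)]
  rw [ENNReal.ofReal_le_ofReal_iff (by positivity)] at hmain
  have h3 : (ω * |u x|) ^ p ≤ ((ω * K) ^ (1/p) * (1 + η) ^ (1/(N:ℝ))) ^ p :=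
    Real.rpow_le_rpow (by positivity) hmain hp0.le
  rw [Real.mul_rpow hω.le (abs_nonneg _), Real.mul_rpow (by positivity) (by positivity), ← Real.rpow_mul (by positivity), ← Real.rpow_mul (by positivity), one_div_mul_cancel hp0.ne', Real.rpow_one] at h3
  have h4 : (1 + η) ^ (1 / (N:ℝ) * p) ≤ 1 + η := by
    calc (1 + η) ^ (1 / (N:ℝ) * p) ≤ (1 + η) ^ (1:ℝ) := by
          apply Real.rpow_le_rpow_of_exponent_le (by linarith)
          rw [hp]
          rw [one_div_mul_eq_div, div_div, div_le_one (by positivity)]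
          nlinarith
      _ = _ := Real.rpow_one _
  have e5 : ω ^ p = ω * ω ^ (1 / ((N:ℝ) - 1)) := by
    nth_rewrite 2 [← Real.rpow_one ω]
    rw [← Real.rpow_add hω]
    congr 1
    rw [hp]
    field_simp
    ring
  rw [Real.rpow_neg hω.le]
  have h6 : 0 < ω ^ (1 / ((N:ℝ) - 1)) := by positivity
  have h7 : ω * (ω ^ (1 / ((N:ℝ) - 1)) * |u x| ^ p) ≤ ω * (K * (1 + η)) := by
    calc _ = ω ^ p * |u x| ^ p := by rw [e5]; ring
      _ ≤ _ := h3
      _ ≤ ω * K * (1 + η) := by gcongr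
      _ = _ := by ring
  have h8 := le_of_mul_le_mul_left h7 hω
  rw [show (1 + η) * ((ω ^ (1 / ((N:ℝ) - 1)))⁻¹ * K) = (K * (1 + η)) / ω ^ (1 / ((N:ℝ) - 1)) by field_simp]
  rw [le_div_iff₀ h6, mul_comm]
  exact h8

lemma MT (N : ℕ) (hN : 2 ≤ N) (α : ℝ) (hα0 : 0 < α) (hα : α < alphaMT N) :
    ∃ A : ENNReal, A ≠ ⊤ ∧ ∀ u : EuclideanSpace ℝ (Fin N) → ℝ, IsTest (unitBall N) u →
      (∫ x in unitBall N, ‖fderiv ℝ u x‖ ^ N) ≤ 1 →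
      ∫⁻ x in unitBall N, ENNReal.ofReal (Real.exp (α * |u x| ^ ((N : ℝ) / ((N : ℝ) - 1)))) ≤ A := by
  have hN1 : (2:ℝ) ≤ N := by exact_mod_cast hN
  have hN2 : (0:ℝ) < (N:ℝ) - 1 := by linarith
  have hω := sphereVol_pos N hN
  set ω := sphereVol N with hωdef
  set a := α * ω ^ (-(1 / ((N:ℝ) - 1))) with ha
  have ha0 : 0 < a := by positivity
  have haN : a < N := by
    unfold alphaMT at hα
    rw [ha, Real.rpow_neg hω.le, ← div_eq_mul_inv, div_lt_iff₀ (by positivity)]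
    exact hα
  set τ := (a + N) / 2 with hτdef
  have hτa : a < τ := by rw [hτdef]; linarith
  have hτN : τ < N := by rw [hτdef]; linarith
  have hτ : 0 < τ := ha0.trans hτa
  set η := min 1 (τ / a - 1) with hη
  have hη0 : 0 < η := by
    apply lt_min one_pos
    rw [sub_pos, lt_div_iff₀ ha0]; linarith
  have hη1 : η ≤ 1 := min_le_left _ _
  have haη : (1 + η) * a ≤ τ := by
    have : η ≤ τ / a - 1 := min_le_right _ _
    rw [← le_div_iff₀ ha0]; linarith
  obtain ⟨A, hA, hGA⟩ := lintegral_GPot N hN τ hτN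
  set c : ℝ := Real.exp (τ * (((N:ℝ) - 1) / τ + Real.log 2)) / η with hc
  have hc0 : 0 < c := by positivity
  refine ⟨ENNReal.ofReal c * (volume (unitBall N) + A), ?_, ?_⟩
  · apply ENNReal.mul_ne_top ENNReal.ofReal_ne_top
    apply ENNReal.add_ne_top.2 ⟨?_, hA⟩
    exact measure_ball_lt_top.ne
  intro u hu hE
  obtain ⟨hGm, hGi⟩ := hGA u hu hE
  have key : ∀ x ∈ unitBall N, ENNReal.ofReal (Real.exp (α * |u x| ^ ((N : ℝ) / ((N : ℝ) - 1)))) ≤ ENNReal.ofReal c * (1 + GPot N τ u x) := by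
    intro x hx
    have hx : ‖x‖ < 1 := by simpa [unitBall] using hx
    by_cases hT : GPot N τ u x = ⊤
    · rw [hT]
      simp [ENNReal.mul_top, hc0]
    set g := (GPot N τ u x).toReal with hg
    have hg0 : 0 ≤ g := ENNReal.toReal_nonneg
    have hGg : GPot N τ u x = ENNReal.ofReal g := (ENNReal.ofReal_toReal hT).symm
    set M := max g 1 with hM
    have hM1 : 1 ≤ M := le_max_right _ _
    have hM0 : 0 < M := by linarith
    set δ := (η / M) ^ (1 / τ) with hδ
    have hδ0 : 0 < δ := by positivity
    have hδ1 : δ ≤ 1 := by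
      apply Real.rpow_le_one (by positivity) _ (by positivity)
      rw [div_le_one hM0]; linarith
    have hδτ : δ ^ τ = η / M := by
      rw [hδ, ← Real.rpow_mul (by positivity), one_div_mul_cancel hτ.ne', Real.rpow_one]
    have hGb : ENNReal.ofReal (δ ^ τ) * GPot N τ u x ≤ ENNReal.ofReal η := by
      rw [hGg, ← ENNReal.ofReal_mul (by positivity), hδτ]
      apply ENNReal.ofReal_le_ofReal
      rw [div_mul_eq_mul_div, div_le_iff₀ hM0]
      gcongr
      exact le_max_left _ _
    have hb := holder_bound N hN τ δ η hτ hδ0 hδ1 hη0.le hu hE x hx hGb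
    have hlogδ : Real.log (2 / δ) = Real.log 2 + (1/τ) * Real.log (M / η) := by
      rw [Real.log_div (by norm_num) hδ0.ne', hδ, Real.log_rpow (by positivity), Real.log_div hη0.ne' hM0.ne', Real.log_div hM0.ne' hη0.ne']
      ring
    have hlog2 : 0 ≤ Real.log (2 / δ) := Real.log_nonneg (by rw [le_div_iff₀ hδ0]; linarith)
    have hexp : Real.exp (α * |u x| ^ ((N : ℝ) / ((N : ℝ) - 1))) ≤ c * M := by
      calc Real.exp (α * |u x| ^ ((N : ℝ) / ((N : ℝ) - 1))) ≤ Real.exp (τ * (((N:ℝ) - 1) / τ + Real.log (2 / δ))) := by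
            apply Real.exp_le_exp.2
            calc _ ≤ α * ((1 + η) * (ω ^ (-(1 / ((N:ℝ) - 1))) * (((N:ℝ) - 1) / τ + Real.log (2 / δ)))) := by gcongr
              _ = ((1 + η) * a) * (((N:ℝ) - 1) / τ + Real.log (2 / δ)) := by rw [ha]; ring
              _ ≤ _ := by gcongr
        _ = Real.exp (τ * (((N:ℝ) - 1) / τ + Real.log 2) + Real.log (M / η)) := by
            rw [hlogδ]
            congr 1
            field_simp
            ring
        _ = c * M := by
            rw [Real.exp_add, Real.exp_log (by positivity), hc]
            ring
    calc _ ≤ ENNReal.ofReal (c * M) := ENNReal.ofReal_le_ofReal hexp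
      _ ≤ ENNReal.ofReal (c * (1 + g)) := by
          apply ENNReal.ofReal_le_ofReal
          gcongr
          apply max_le <;> linarith
      _ = _ := by
          rw [ENNReal.ofReal_mul hc0.le, ENNReal.ofReal_add zero_le_one hg0, ENNReal.ofReal_one, hGg]
  calc _ ≤ ∫⁻ x in unitBall N, ENNReal.ofReal c * (1 + GPot N τ u x) := by
        apply setLIntegral_mono' _ key
        exact measurableSet_ball
    _ = ENNReal.ofReal c * (volume (unitBall N) + ∫⁻ x in unitBall N, GPot N τ u x) := by
        rw [lintegral_const_mul' _ _ ENNReal.ofReal_ne_top, lintegral_add_left measurable_const]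
        simp
    _ ≤ _ := by
        gcongr
        exact (setLIntegral_le_lintegral _ _).trans hGi


lemma smoothTransition_deriv_bound : ∃ K : ℝ, 0 < K ∧ ∀ s : ℝ, |deriv Real.smoothTransition s| ≤ K := by
  have hc : Continuous (deriv Real.smoothTransition) :=
    (Real.smoothTransition.contDiff (n := 1)).continuous_deriv le_rfl
  have hs : HasCompactSupport (deriv Real.smoothTransition) := by
    apply HasCompactSupport.intro (isCompact_Icc (a := (0:ℝ)) (b := 1))
    intro s hs
    rw [Set.mem_Icc, not_and_or, not_le, not_le] at hs
    rcases hs with hs | hs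
    · have : Real.smoothTransition =ᶠ[nhds s] fun _ => 0 := by
        filter_upwards [gt_mem_nhds hs] with t ht
        exact Real.smoothTransition.zero_of_nonpos (le_of_lt ht)
      rw [this.deriv_eq]; simp
    · have : Real.smoothTransition =ᶠ[nhds s] fun _ => 1 := by
        filter_upwards [lt_mem_nhds hs] with t ht
        exact Real.smoothTransition.one_of_one_le (le_of_lt ht)
      rw [this.deriv_eq]; simp
  obtain ⟨C, hC⟩ := hc.bounded_above_of_compact_support hs
  refine ⟨max C 1, by positivity, fun s => ?_⟩
  exact (hC s).trans (le_max_left _ _)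

lemma cap_radial (N : ℕ) (hN : 2 ≤ N) (r ε D : ℝ) (hr : 0 < r) (hε : 0 < ε) (hD : 0 ≤ D) :
    ∫⁻ t in Set.Ioi (0:ℝ), ENNReal.ofReal (t ^ (N-1)) *
      ENNReal.ofReal (if t ≤ r then (D * (t / (t ^ 2 + ε))) ^ N else 0) ≤
      ENNReal.ofReal (D ^ N * (Real.log ((r ^ 2 + ε) / ε) / 2)) := by
  have hcont : Continuous (fun t : ℝ => D ^ N * (t / (t ^ 2 + ε))) := by
    apply continuous_const.mul
    apply Continuous.div (by fun_prop) (by fun_prop)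
    intro t
    positivity
  calc _ = ∫⁻ t in Set.Ioc (0:ℝ) r ∪ Set.Ioi r, ENNReal.ofReal (t ^ (N-1)) *
      ENNReal.ofReal (if t ≤ r then (D * (t / (t ^ 2 + ε))) ^ N else 0) := by
        rw [Set.Ioc_union_Ioi_eq_Ioi hr.le]
    _ ≤ _ := lintegral_union_le _ _ _
    _ ≤ (∫⁻ t in Set.Ioc (0:ℝ) r, ENNReal.ofReal (D ^ N * (t / (t ^ 2 + ε)))) + 0 := by
        apply add_le_add
        · apply setLIntegral_mono' measurableSet_Ioc
          intro t ht
          have ht0 : 0 < t := ht.1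
          rw [if_pos ht.2, ← ENNReal.ofReal_mul (by positivity)]
          apply ENNReal.ofReal_le_ofReal
          rw [mul_pow]
          obtain ⟨k, rfl⟩ : ∃ k, N = k + 1 := ⟨N - 1, by omega⟩
          simp only [Nat.add_sub_cancel]
          have h1 : (t * (t / (t ^ 2 + ε))) ^ k ≤ 1 := by
            apply pow_le_one₀ (by positivity)
            rw [← mul_div_assoc, div_le_one (by positivity)]
            nlinarith
          calc t ^ k * (D ^ (k+1) * (t / (t ^ 2 + ε)) ^ (k+1)) = (t * (t / (t ^ 2 + ε))) ^ k * (D ^ (k+1) * (t / (t ^ 2 + ε))) := by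
                rw [mul_pow, pow_succ (t / (t ^ 2 + ε)) k]; ring
            _ ≤ 1 * (D ^ (k+1) * (t / (t ^ 2 + ε))) := by gcongr
            _ = _ := one_mul _
        · apply le_of_eq
          rw [setLIntegral_congr_fun (g := fun _ => 0) measurableSet_Ioi]
          · simp
          · intro t ht
            have ht : r < t := ht
            simp [not_le.2 ht]
    _ = ENNReal.ofReal (∫ t in (0:ℝ)..r, D ^ N * (t / (t ^ 2 + ε))) := by
        rw [add_zero, intervalIntegral.integral_of_le hr.le, ofReal_integral_eq_lintegral_ofReal]
        · exact (intervalIntegrable_iff_integrableOn_Ioc_of_le hr.le).1 (hcont.intervalIntegrable _ _)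
        · filter_upwards [ae_restrict_mem measurableSet_Ioc] with t ht
          have ht0 : 0 < t := ht.1
          simp only [Pi.zero_apply]
          positivity
    _ = _ := by
        congr 1
        have : ∀ t ∈ Set.uIcc (0:ℝ) r, HasDerivAt (fun t : ℝ => D ^ N * (Real.log (t ^ 2 + ε) / 2)) (D ^ N * (t / (t ^ 2 + ε))) t := by
          intro t _
          have h1 : HasDerivAt (fun t : ℝ => t ^ 2 + ε) (2 * t) t := by
            simpa using (hasDerivAt_pow 2 t).add_const ε
          have h2 := ((h1.log (by positivity)).div_const 2).const_mul (D ^ N)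
          refine h2.congr_deriv ?_
          ring
        rw [intervalIntegral.integral_eq_sub_of_hasDerivAt this (hcont.intervalIntegrable _ _)]
        rw [Real.log_div (by positivity) hε.ne']
        simp
        ring

lemma cap_exists (N : ℕ) (hN : 2 ≤ N) (x : EuclideanSpace ℝ (Fin N)) (hx : ‖x‖ < 1) (T : ℝ) (hT : 0 < T) :
    ∃ v : EuclideanSpace ℝ (Fin N) → ℝ, IsTest (unitBall N) v ∧
      (∫ y in unitBall N, ‖fderiv ℝ v y‖ ^ N) ≤ 1 ∧
      ∃ r : ℝ, 0 < r ∧ ∀ y, ‖y - x‖ < r → v y = T := by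
  obtain ⟨K, hK0, hK⟩ := smoothTransition_deriv_bound
  have hω := sphereVol_pos N hN
  set r := (1 - ‖x‖) / 2 with hr
  have hr0 : 0 < r := by rw [hr]; linarith
  set C := sphereVol N * (2 * T * K) ^ N * (3 / 2) with hC
  have hC0 : 0 < C := by positivity
  set L := max 1 C with hL
  have hL1 : 1 ≤ L := le_max_left _ _
  have hL0 : 0 < L := by linarith
  set ε := r ^ 2 * Real.exp (-L) / 2 with hε
  have hε0 : 0 < ε := by positivity
  set φ : EuclideanSpace ℝ (Fin N) → ℝ := fun y => (Real.log (r ^ 2) - Real.log (‖y - x‖ ^ 2 + ε)) / L with hφ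
  set v : EuclideanSpace ℝ (Fin N) → ℝ := fun y => T * Real.smoothTransition (φ y) with hv
  have hvz : ∀ y, r ≤ ‖y - x‖ → v y = 0 := by
    intro y hy
    have : φ y ≤ 0 := by
      apply div_nonpos_of_nonpos_of_nonneg _ hL0.le
      rw [sub_nonpos]
      apply Real.log_le_log (by positivity)
      have : r ^ 2 ≤ ‖y - x‖ ^ 2 := by gcongr
      linarith
    simp [hv, Real.smoothTransition.zero_of_nonpos this]
  have hts : tsupport v ⊆ Metric.closedBall x r := by
    apply closure_minimal _ Metric.isClosed_closedBall
    intro y hy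
    by_contra h
    apply hy
    apply hvz
    rw [Metric.mem_closedBall, dist_eq_norm, not_le] at h
    exact h.le
  have hsm : ContDiff ℝ (⊤ : ℕ∞) v := by
    apply contDiff_const.mul
    apply Real.smoothTransition.contDiff.comp
    apply ContDiff.div_const
    apply contDiff_const.sub
    apply ContDiff.log
    · exact ((contDiff_id.sub contDiff_const).norm_sq ℝ).add contDiff_const
    · intro y; positivity
  have htest : IsTest (unitBall N) v := by
    refine ⟨hsm, ?_, ?_⟩
    · exact HasCompactSupport.of_support_subset_isCompact (isCompact_closedBall x r) (subset_closure.trans hts)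
    · refine hts.trans ?_
      intro y hy
      rw [Metric.mem_closedBall, dist_eq_norm] at hy
      have : ‖y‖ ≤ ‖y - x‖ + ‖x‖ := by simpa using norm_add_le (y - x) x
      simp only [unitBall, Metric.mem_ball, dist_zero_right]
      rw [hr] at hy
      linarith
  refine ⟨v, htest, ?_, Real.sqrt ε, by positivity, ?_⟩
  · set D := 2 * T * K / L with hD
    have hD0 : 0 < D := by positivity
    set h : ℝ → ENNReal := fun t => ENNReal.ofReal (if t ≤ r then (D * (t / (t ^ 2 + ε))) ^ N else 0) with hh
    have hhm : Measurable h := by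
      apply ENNReal.measurable_ofReal.comp
      exact Measurable.ite (measurableSet_le (by fun_prop) (by fun_prop)) (by fun_prop) measurable_const
    have hbound : ∀ y, ENNReal.ofReal (‖fderiv ℝ v y‖ ^ N) ≤ h ‖y - x‖ := by
      intro y
      simp only [hh]
      apply ENNReal.ofReal_le_ofReal
      split_ifs with hy
      · gcongr
        have h1 : HasFDerivAt (fun y : EuclideanSpace ℝ (Fin N) => y - x) (ContinuousLinearMap.id ℝ _) y :=
          (hasFDerivAt_id y).sub_const x
        have h2 := (h1.norm_sq).add_const ε
        have h3 := h2.log (by positivity)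
        have h4 : HasFDerivAt φ _ y := (h3.const_sub (Real.log (r^2))).mul_const (L⁻¹)
        have h5 : HasDerivAt Real.smoothTransition (deriv Real.smoothTransition (φ y)) (φ y) :=
          ((Real.smoothTransition.contDiff (n := 1)).differentiable (by simp) _).hasDerivAt
        have h6 := (h5.comp_hasFDerivAt y h4).const_mul T
        have h7 : fderiv ℝ v y = _ := h6.fderiv
        rw [h7]
        have hi : ‖(innerSL ℝ (y - x)).comp (ContinuousLinearMap.id ℝ (EuclideanSpace ℝ (Fin N)))‖ = ‖y - x‖ := by
          rw [ContinuousLinearMap.comp_id, innerSL_apply_norm]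
        have hi2 : ‖(2:ℕ) • (innerSL ℝ (y - x)).comp (ContinuousLinearMap.id ℝ (EuclideanSpace ℝ (Fin N)))‖ = 2 * ‖y - x‖ := by
          rw [← Nat.cast_smul_eq_nsmul ℝ, norm_smul, hi]
          simp
        simp only [norm_smul, norm_neg, hi2, norm_inv, Real.norm_eq_abs]
        rw [abs_of_pos hT, abs_of_pos hL0, abs_of_pos (by positivity : 0 < ‖y - x‖ ^ 2 + ε)]
        calc T * (|deriv Real.smoothTransition (φ y)| * (L⁻¹ * ((‖y - x‖ ^ 2 + ε)⁻¹ * (2 * ‖y - x‖)))) 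
            ≤ T * (K * (L⁻¹ * ((‖y - x‖ ^ 2 + ε)⁻¹ * (2 * ‖y - x‖)))) := by
              gcongr
              exact hK _
          _ = _ := by rw [hD]; field_simp
      · have : fderiv ℝ v y = 0 := by
          by_contra hne
          have h1 : y ∈ tsupport (fderiv ℝ v) := subset_tsupport _ hne
          have h2 := hts (tsupport_fderiv_subset ℝ h1)
          rw [Metric.mem_closedBall, dist_eq_norm] at h2
          exact hy h2
        rw [this, norm_zero, zero_pow (by omega)]
    have hlint : ∫⁻ y in unitBall N, ENNReal.ofReal (‖fderiv ℝ v y‖ ^ N) ≤ ENNReal.ofReal 1 := by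
      calc _ ≤ ∫⁻ y, ENNReal.ofReal (‖fderiv ℝ v y‖ ^ N) := setLIntegral_le_lintegral _ _
        _ ≤ ∫⁻ y, h ‖y - x‖ := lintegral_mono hbound
        _ = ∫⁻ y : EuclideanSpace ℝ (Fin N), h ‖y‖ := lintegral_sub_right_eq_self (fun y => h ‖y‖) x
        _ = _ := polar_radial N hN h hhm
        _ ≤ ENNReal.ofReal (sphereVol N) * ENNReal.ofReal (D ^ N * (Real.log ((r ^ 2 + ε) / ε) / 2)) := by
            gcongr
            exact cap_radial N hN r ε D hr0 hε0 hD0.le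
        _ ≤ ENNReal.ofReal 1 := by
            rw [← ENNReal.ofReal_mul hω.le]
            apply ENNReal.ofReal_le_ofReal
            have hl : Real.log ((r ^ 2 + ε) / ε) ≤ 3 * L := by
              have e1 : (r ^ 2 + ε) / ε = 2 * Real.exp L + 1 := by
                rw [hε, Real.exp_neg]
                have := Real.exp_pos L
                field_simp
              have h3 : (3:ℝ) ≤ Real.exp 2 := by
                have := Real.add_one_le_exp (2:ℝ)
                linarith
              have h4 : (1:ℝ) ≤ Real.exp L := Real.one_le_exp hL0.le
              rw [e1, Real.log_le_iff_le_exp (by positivity)]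
              calc 2 * Real.exp L + 1 ≤ 3 * Real.exp L := by linarith
                _ ≤ Real.exp 2 * Real.exp L := by gcongr
                _ = Real.exp (2 + L) := (Real.exp_add _ _).symm
                _ ≤ _ := Real.exp_le_exp.2 (by linarith)
            calc sphereVol N * (D ^ N * (Real.log ((r ^ 2 + ε) / ε) / 2)) ≤ sphereVol N * (D ^ N * (3 * L / 2)) := by gcongr
              _ = C * L / L ^ N := by
                  rw [hD, hC, div_pow]; ring
              _ ≤ 1 := by
                  rw [div_le_one (by positivity)]
                  calc C * L ≤ L * L := by gcongr; exact le_max_right _ _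
                    _ = L ^ 2 := by ring
                    _ ≤ L ^ N := pow_le_pow_right₀ hL1 hN
    rw [integral_eq_lintegral_of_nonneg_ae (Eventually.of_forall fun y => by positivity)]
    · exact ENNReal.toReal_le_of_le_ofReal zero_le_one hlint
    · have : Continuous (fderiv ℝ v) := hsm.continuous_fderiv (by simp)
      exact (this.norm.pow N).aestronglyMeasurable
  · intro y hy
    have hy2 : ‖y - x‖ ^ 2 < ε := by
      have := Real.lt_sqrt (norm_nonneg (y - x)) |>.1 hy
      exact this
    have : 1 ≤ φ y := by
      simp only [hφ]
      rw [le_div_iff₀ hL0, one_mul]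
      have h1 : Real.log (‖y - x‖ ^ 2 + ε) ≤ Real.log (r ^ 2 * Real.exp (-L)) := by
        apply Real.log_le_log (by positivity)
        rw [hε] at hy2 ⊢
        linarith
      rw [Real.log_mul (by positivity) (by positivity), Real.log_exp] at h1
      linarith
    simp [hv, Real.smoothTransition.one_of_one_le this]


lemma integrable_ball {N : ℕ} {g : EuclideanSpace ℝ (Fin N) → ℝ} (hg : Continuous g) :
    Integrable g (volume.restrict (unitBall N)) := by
  have : IntegrableOn g (Metric.closedBall 0 1) volume :=
    hg.continuousOn.integrableOn_compact (isCompact_closedBall 0 1)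
  exact this.mono_set Metric.ball_subset_closedBall

lemma f1_bound (N : ℕ) (hN : 2 ≤ N) (f₁ : ℝ → ℝ) (hc1 : Continuous f₁)
    (hpos1 : ∀ t, 0 ≤ f₁ t)
    (h1 : ∃ C : ℝ, 0 < C ∧ ∃ α : ℝ, 0 < α ∧ α < alphaMT N ∧
      ∀ t, f₁ t ≤ C * PhiGamma N α t) :
    ∃ A : ℝ, 0 ≤ A ∧ ∀ u : EuclideanSpace ℝ (Fin N) → ℝ, IsTest (unitBall N) u →
      (∫ x in unitBall N, ‖fderiv ℝ u x‖ ^ N) ≤ 1 → ∫ x in unitBall N, f₁ (u x) ≤ A := by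
  obtain ⟨C, hC, α, hα0, hα, hf⟩ := h1
  obtain ⟨A, hA, hMT⟩ := MT N hN α hα0 hα
  refine ⟨C * A.toReal, by positivity, ?_⟩
  intro u hu hE
  have hcu : Continuous u := hu.1.continuous
  rw [integral_eq_lintegral_of_nonneg_ae (Eventually.of_forall fun y => hpos1 _) (hc1.comp hcu).aestronglyMeasurable]
  apply ENNReal.toReal_le_of_le_ofReal (by positivity)
  rw [ENNReal.ofReal_mul hC.le, ENNReal.ofReal_toReal hA]
  calc _ ≤ ∫⁻ x in unitBall N, ENNReal.ofReal C * ENNReal.ofReal (Real.exp (α * |u x| ^ ((N : ℝ) / ((N : ℝ) - 1)))) := by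
        apply lintegral_mono
        intro x
        simp only
        rw [← ENNReal.ofReal_mul hC.le]
        apply ENNReal.ofReal_le_ofReal
        refine (hf _).trans ?_
        gcongr
        unfold PhiGamma
        rw [sub_le_self_iff]
        apply Finset.sum_nonneg
        intro j _
        positivity
    _ = ENNReal.ofReal C * ∫⁻ x in unitBall N, ENNReal.ofReal (Real.exp (α * |u x| ^ ((N : ℝ) / ((N : ℝ) - 1)))) :=
        lintegral_const_mul' _ _ ENNReal.ofReal_ne_top
    _ ≤ _ := by
        gcongr
        exact hMT u hu hE

lemma apply_abs_of_even {f : ℝ → ℝ} (hf : ∀ t, f (-t) = f t) (t : ℝ) : f |t| = f t := by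
  rcases abs_choice t with h | h <;> rw [h]
  exact hf t

lemma local_weight (N : ℕ) (hN : 2 ≤ N) (f₁ f₂ : ℝ → ℝ)
    (hc1 : Continuous f₁) (hc2 : Continuous f₂)
    (hpos1 : ∀ t, 0 ≤ f₁ t) (hpos2 : ∀ t, 0 ≤ f₂ t)
    (heven1 : ∀ t, f₁ (-t) = f₁ t) (heven2 : ∀ t, f₂ (-t) = f₂ t)
    (hmono1 : MonotoneOn f₁ (Set.Ici (0 : ℝ)))
    (hf2pos : ∀ t : ℝ, 0 < t → 0 < f₂ t)
    (h2 : Tendsto (fun t => f₁ t / f₂ t) atTop (nhds 0))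
    (A : ℝ) (hA : ∀ u : EuclideanSpace ℝ (Fin N) → ℝ, IsTest (unitBall N) u →
      (∫ x in unitBall N, ‖fderiv ℝ u x‖ ^ N) ≤ 1 → ∫ x in unitBall N, f₁ (u x) ≤ A)
    (T₀ : ℝ) (hT₀ : 0 < T₀) (hfT₀ : 0 < f₁ T₀)
    (x : EuclideanSpace ℝ (Fin N)) (hx : ‖x‖ < 1) (U : Set (EuclideanSpace ℝ (Fin N)))
    (hU : IsOpen U) (hxU : x ∈ U) (M : ℝ) (hM : 0 < M) :
    ∃ w : EuclideanSpace ℝ (Fin N) → ℝ, Continuous w ∧ (∀ y, 0 ≤ w y) ∧ (∀ y, y ∉ U → w y = 0) ∧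
      (∀ u : EuclideanSpace ℝ (Fin N) → ℝ, IsTest (unitBall N) u →
        (∫ x in unitBall N, ‖fderiv ℝ u x‖ ^ N) ≤ 1 → ∫ x in unitBall N, f₁ (u x) * w x ≤ 1) ∧
      (∃ u : EuclideanSpace ℝ (Fin N) → ℝ, IsTest (unitBall N) u ∧
        (∫ x in unitBall N, ‖fderiv ℝ u x‖ ^ N) ≤ 1 ∧ M ≤ ∫ x in unitBall N, f₂ (u x) * w x) ∧
      ∫ x in unitBall N, w x ≤ 1 / f₁ T₀ := by
  obtain ⟨T, hTT₀, hTM⟩ : ∃ T, T₀ ≤ T ∧ ∀ t, T ≤ t → (4 * M) * f₁ t ≤ f₂ t := by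
    have := h2.eventually (gt_mem_nhds (show (0:ℝ) < 1 / (4 * M) by positivity))
    obtain ⟨T1, hT1⟩ := eventually_atTop.1 this
    refine ⟨max T1 T₀, le_max_right _ _, ?_⟩
    intro t ht
    have ht0 : 0 < t := hT₀.trans_le ((le_max_right _ _).trans ht)
    have h := hT1 t ((le_max_left _ _).trans ht)
    rw [div_lt_iff₀ (hf2pos t ht0), one_div_mul_eq_div, lt_div_iff₀ (by positivity)] at h
    linarith
  have hT : 0 < T := by linarith
  have hfT : f₁ T₀ ≤ f₁ T := hmono1 hT₀.le hT.le hTT₀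
  obtain ⟨v, hv, hvE, r, hr, hvT⟩ := cap_exists N hN x hx T hT
  obtain ⟨s, hs, hsub⟩ : ∃ s > 0, Metric.ball x s ⊆ U ∩ unitBall N ∩ Metric.ball x r := by
    apply Metric.isOpen_iff.1 ((hU.inter Metric.isOpen_ball).inter Metric.isOpen_ball)
    refine ⟨⟨hxU, ?_⟩, Metric.mem_ball_self hr⟩
    simpa using hx
  set w₀ : EuclideanSpace ℝ (Fin N) → ℝ := fun y => max 0 (1 - ‖y - x‖ / s) with hw₀
  have hw0c : Continuous w₀ := by
    simp only [hw₀]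
    fun_prop
  have hw00 : ∀ y, 0 ≤ w₀ y := fun y => le_max_left _ _
  have hw01 : ∀ y, w₀ y ≤ 1 := by
    intro y
    apply max_le zero_le_one
    have : 0 ≤ ‖y - x‖ / s := by positivity
    linarith
  have hw0s : ∀ y, w₀ y ≠ 0 → y ∈ U ∩ unitBall N ∩ Metric.ball x r := by
    intro y hy
    apply hsub
    rw [Metric.mem_ball, dist_eq_norm]
    by_contra h
    rw [not_lt] at h
    apply hy
    apply max_eq_left
    rw [sub_nonpos, le_div_iff₀ hs]
    linarith
  have hwint : 0 < ∫ y in unitBall N, w₀ y := by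
    rw [setIntegral_eq_integral_of_forall_compl_eq_zero]
    · apply hw0c.integral_pos_of_hasCompactSupport_nonneg_nonzero (x := x) _ hw00
      · simp [hw₀]
      · apply HasCompactSupport.intro (isCompact_closedBall (0 : EuclideanSpace ℝ (Fin N)) 1)
        intro y hy
        by_contra h
        exact hy (Metric.ball_subset_closedBall (hw0s y h).1.2)
    · intro y hy
      by_contra h
      exact hy (hw0s y h).1.2
  have hInt0 : ∀ (f : ℝ → ℝ) (u : EuclideanSpace ℝ (Fin N) → ℝ), Continuous f → IsTest (unitBall N) u →
      Integrable (fun y => f (u y) * w₀ y) (volume.restrict (unitBall N)) := by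
    intro f u hf hu
    exact integrable_ball ((hf.comp hu.1.continuous).mul hw0c)
  set Sset : Set ℝ := {r : ℝ | ∃ u : EuclideanSpace ℝ (Fin N) → ℝ, IsTest (unitBall N) u ∧
        (∫ x in unitBall N, ‖fderiv ℝ u x‖ ^ N) ≤ 1 ∧ r = ∫ x in unitBall N, f₁ (u x) * w₀ x} with hSset
  have hbdd : BddAbove Sset := by
    refine ⟨A, ?_⟩
    rintro _ ⟨u, hu, hE, rfl⟩
    refine le_trans ?_ (hA u hu hE)
    apply integral_mono (hInt0 f₁ u hc1 hu) (integrable_ball (hc1.comp hu.1.continuous))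
    intro y
    exact mul_le_of_le_one_right (hpos1 _) (hw01 y)
  set S := sSup Sset with hS
  have hvmem : (∫ x in unitBall N, f₁ (v x) * w₀ x) ∈ Sset := ⟨v, hv, hvE, rfl⟩
  have hSlow : f₁ T * ∫ y in unitBall N, w₀ y ≤ S := by
    refine le_trans ?_ (le_csSup hbdd hvmem)
    rw [← integral_const_mul]
    apply integral_mono ((integrable_ball hw0c).const_mul _) (hInt0 f₁ v hc1 hv)
    intro y
    simp only
    by_cases h : w₀ y = 0
    · simp [h]
    · have : v y = T := hvT y (by simpa [dist_eq_norm] using (hw0s y h).2)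
      rw [this]
  have hS0 : 0 < S := lt_of_lt_of_le (mul_pos (hfT₀.trans_le hfT) hwint) hSlow
  obtain ⟨_, ⟨u₀, hu₀, hu₀E, rfl⟩, hu₀S⟩ := exists_lt_of_lt_csSup ⟨_, hvmem⟩ (show S / 2 < S by linarith)
  have hcomp : (4 * M) * ∫ y in unitBall N, f₁ (u₀ y) * w₀ y ≤
      (∫ y in unitBall N, f₂ (v y) * w₀ y) + ∫ y in unitBall N, f₂ (u₀ y) * w₀ y := by
    rw [← integral_add (hInt0 f₂ v hc2 hv) (hInt0 f₂ u₀ hc2 hu₀), ← integral_const_mul]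
    apply integral_mono ((hInt0 f₁ u₀ hc1 hu₀).const_mul _) ((hInt0 f₂ v hc2 hv).add (hInt0 f₂ u₀ hc2 hu₀))
    intro y
    simp only [Pi.add_apply]
    by_cases h : w₀ y = 0
    · simp [h]
    have hvy : v y = T := hvT y (by simpa [dist_eq_norm] using (hw0s y h).2)
    rw [hvy, ← add_mul, ← mul_assoc]
    apply mul_le_mul_of_nonneg_right _ (hw00 y)
    rcases le_total |u₀ y| T with h' | h'
    · have e1 : f₁ (u₀ y) ≤ f₁ T := by
        rw [← apply_abs_of_even heven1]
        exact hmono1 (abs_nonneg (u₀ y)) hT.le h'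
      have e2 := hTM T le_rfl
      have e3 := hpos2 (u₀ y)
      nlinarith
    · have e2 := hTM _ h'
      rw [apply_abs_of_even heven1, apply_abs_of_even heven2] at e2
      have e3 := hpos2 T
      linarith
  have hSM : 2 * (M * S) ≤ (∫ y in unitBall N, f₂ (v y) * w₀ y) + ∫ y in unitBall N, f₂ (u₀ y) * w₀ y := by
    refine le_trans ?_ hcomp
    nlinarith
  have hscale : ∀ (f : ℝ → ℝ) (u : EuclideanSpace ℝ (Fin N) → ℝ),
      ∫ y in unitBall N, f (u y) * (w₀ y / S) = (∫ y in unitBall N, f (u y) * w₀ y) / S := by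
    intro f u
    rw [← integral_div]
    congr 1
    ext y
    ring
  refine ⟨fun y => w₀ y / S, hw0c.div_const S, fun y => div_nonneg (hw00 y) hS0.le, ?_, ?_, ?_, ?_⟩
  · intro y hy
    have : w₀ y = 0 := by
      by_contra h
      exact hy (hw0s y h).1.1
    simp [this]
  · intro u hu hE
    rw [hscale, div_le_one hS0]
    exact le_csSup hbdd ⟨u, hu, hE, rfl⟩
  · rcases le_total (M * S) (∫ y in unitBall N, f₂ (v y) * w₀ y) with h | h
    · refine ⟨v, hv, hvE, ?_⟩
      rw [hscale, le_div_iff₀ hS0]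
      exact h
    · refine ⟨u₀, hu₀, hu₀E, ?_⟩
      rw [hscale, le_div_iff₀ hS0]
      linarith
  · rw [integral_div, div_le_div_iff₀ hS0 hfT₀]
    nlinarith



/-- Given even, continuous, nonnegative nonlinearities `f₁, f₂` nondecreasing on `[0,∞)` with
`f₁ ≤ C Φ^α` for some `α < α_N`, `f₁/f₂ → 0` at `+∞`, and
`liminf_{R→0⁺} R^N f̃₁(R) / ∫₀^R f̃₁(ρ)ρ^{N-1}dρ > 0`, there is a conformal metric
`g_ρ = ρ g_e` on the unit ball such that the `f₁`-functional is uniformly bounded on the unit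
ball of the Dirichlet energy while the `f₂`-functional is not. -/
theorem exists_metric_separating_nonlinearities (N : ℕ) (hN : 2 ≤ N) (f₁ f₂ : ℝ → ℝ)
    (hc1 : Continuous f₁) (hc2 : Continuous f₂)
    (hpos1 : ∀ t, 0 ≤ f₁ t) (hpos2 : ∀ t, 0 ≤ f₂ t)
    (heven1 : ∀ t, f₁ (-t) = f₁ t) (heven2 : ∀ t, f₂ (-t) = f₂ t)
    (hmono1 : MonotoneOn f₁ (Set.Ici (0 : ℝ))) (hmono2 : MonotoneOn f₂ (Set.Ici (0 : ℝ)))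
    (hf2pos : ∀ t : ℝ, 0 < t → 0 < f₂ t)
    (h1 : ∃ C : ℝ, 0 < C ∧ ∃ α : ℝ, 0 < α ∧ α < alphaMT N ∧
      ∀ t, f₁ t ≤ C * PhiGamma N α t)
    (h2 : Tendsto (fun t => f₁ t / f₂ t) atTop (nhds 0))
    (h3 : 0 < Filter.liminf
      (fun R : ℝ => R ^ N * ftilde N f₁ R / ∫ s in Set.Ioo (0 : ℝ) R, ftilde N f₁ s * s ^ (N - 1))
      (nhdsWithin 0 (Set.Ioi 0))) :
    ∃ ρ : EuclideanSpace ℝ (Fin N) → ℝ, ContinuousOn ρ (unitBall N) ∧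
      (∀ x ∈ unitBall N, 0 < ρ x) ∧
      BddAbove {r : ℝ | ∃ u : EuclideanSpace ℝ (Fin N) → ℝ, IsTest (unitBall N) u ∧
        (∫ x in unitBall N, ‖fderiv ℝ u x‖ ^ N) ≤ 1 ∧
        r = ∫ x in unitBall N, f₁ (u x) * ρ x ^ ((N : ℝ) / 2)} ∧
      ¬ BddAbove {r : ℝ | ∃ u : EuclideanSpace ℝ (Fin N) → ℝ, IsTest (unitBall N) u ∧
        (∫ x in unitBall N, ‖fderiv ℝ u x‖ ^ N) ≤ 1 ∧
        r = ∫ x in unitBall N, f₂ (u x) * ρ x ^ ((N : ℝ) / 2)} := by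
  obtain ⟨A, hA0, hA⟩ := f1_bound N hN f₁ hc1 hpos1 h1
  obtain ⟨T₀, hT₀, hfT₀⟩ : ∃ T₀, 0 < T₀ ∧ 0 < f₁ T₀ := by
    by_contra hcon
    push Not at hcon
    have hz : ∀ t, 0 < t → f₁ t = 0 := fun t ht => le_antisymm (hcon t ht) (hpos1 t)
    have hz0 : f₁ 0 = 0 := by
      apply le_antisymm _ (hpos1 0)
      refine le_trans ?_ (hz 1 one_pos).le
      exact hmono1 (Set.mem_Ici.2 le_rfl) (Set.mem_Ici.2 zero_le_one) zero_le_one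
    have hzz : ∀ t, f₁ t = 0 := by
      intro t
      rw [← apply_abs_of_even heven1]
      rcases (abs_nonneg t).eq_or_lt with h | h
      · rw [← h]; exact hz0
      · exact hz _ h
    have hfun : ∀ R, ftilde N f₁ R = 0 := fun R => hzz _
    simp only [hfun, mul_zero, zero_div, liminf_const, lt_irrefl] at h3
  have hex : ∀ k : ℕ, ∃ w : EuclideanSpace ℝ (Fin N) → ℝ, Continuous w ∧ (∀ y, 0 ≤ w y) ∧
      (∀ y, y ∉ {y : EuclideanSpace ℝ (Fin N) | 1 - 1 / ((k:ℝ) + 1) < ‖y‖} → w y = 0) ∧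
      (∀ u : EuclideanSpace ℝ (Fin N) → ℝ, IsTest (unitBall N) u →
        (∫ x in unitBall N, ‖fderiv ℝ u x‖ ^ N) ≤ 1 → ∫ x in unitBall N, f₁ (u x) * w x ≤ 1) ∧
      (∃ u : EuclideanSpace ℝ (Fin N) → ℝ, IsTest (unitBall N) u ∧
        (∫ x in unitBall N, ‖fderiv ℝ u x‖ ^ N) ≤ 1 ∧ (4:ℝ) ^ k ≤ ∫ x in unitBall N, f₂ (u x) * w x) ∧
      ∫ x in unitBall N, w x ≤ 1 / f₁ T₀ := by
    intro k
    have hk : 1 / ((k:ℝ) + 2) < 1 / ((k:ℝ) + 1) := by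
      apply one_div_lt_one_div_of_lt (by positivity) (by linarith)
    have hk1 : 1 / ((k:ℝ) + 2) ≤ 1 := by
      rw [div_le_one (by positivity)]
      have : (0:ℝ) ≤ k := by positivity
      linarith
    have hk2 : 0 < 1 / ((k:ℝ) + 2) := by positivity
    have hnorm : ‖(1 - 1 / ((k:ℝ) + 2)) • (EuclideanSpace.single (⟨0, by omega⟩ : Fin N) (1:ℝ))‖ = 1 - 1 / ((k:ℝ) + 2) := by
      rw [norm_smul, EuclideanSpace.norm_single, norm_one, mul_one, Real.norm_eq_abs, abs_of_nonneg (by linarith)]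
    apply local_weight N hN f₁ f₂ hc1 hc2 hpos1 hpos2 heven1 heven2 hmono1 hf2pos h2 A hA T₀ hT₀ hfT₀
      ((1 - 1 / ((k:ℝ) + 2)) • (EuclideanSpace.single (⟨0, by omega⟩ : Fin N) (1:ℝ)))
    · rw [hnorm]; linarith
    · exact isOpen_lt continuous_const continuous_norm
    · rw [Set.mem_setOf_eq, hnorm]; linarith
    · positivity
  choose w hwc hw0 hwU hwf₁ hwf₂ hwi using hex
  set V : ℕ → EuclideanSpace ℝ (Fin N) → ℝ := fun k y => if k = 0 then 1 else (1/2:ℝ) ^ k * w k y with hV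
  have hVc : ∀ k, Continuous (V k) := by
    intro k
    simp only [hV]
    split_ifs
    · exact continuous_const
    · exact continuous_const.mul (hwc k)
  have hV0 : ∀ k y, 0 ≤ V k y := by
    intro k y
    simp only [hV]
    split_ifs
    · exact zero_le_one
    · have := hw0 k y
      positivity
  -- local finiteness
  have hloc : ∀ n : ℕ, ∀ y : EuclideanSpace ℝ (Fin N), ‖y‖ < 1 - 1 / ((n:ℝ) + 1) → ∀ k ∉ Finset.range (n+1), V k y = 0 := by
    intro n y hy k hk
    have hk' : n + 1 ≤ k := by simpa using hk
    simp only [hV]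
    rw [if_neg (by omega), hwU k y, mul_zero]
    rw [Set.mem_setOf_eq, not_lt]
    have : 1 / ((k:ℝ) + 1) ≤ 1 / ((n:ℝ) + 1) := by
      apply one_div_le_one_div_of_le (by positivity)
      have : (n:ℝ) + 1 ≤ k := by exact_mod_cast hk'
      linarith
    linarith
  have hn : ∀ y ∈ unitBall N, ∃ n : ℕ, ‖y‖ < 1 - 1 / ((n:ℝ) + 1) := by
    intro y hy
    have hy : ‖y‖ < 1 := by simpa [unitBall] using hy
    obtain ⟨n, hn⟩ := exists_nat_one_div_lt (sub_pos.2 hy)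
    exact ⟨n, by linarith⟩
  have hsum : ∀ y ∈ unitBall N, Summable (fun k => V k y) := by
    intro y hy
    obtain ⟨n, hn⟩ := hn y hy
    exact summable_of_ne_finset_zero (hloc n y hn)
  set W : EuclideanSpace ℝ (Fin N) → ℝ := fun y => ∑' k, V k y with hW
  have hW0 : ∀ y, 0 ≤ W y := fun y => tsum_nonneg (fun k => hV0 k y)
  have hW1 : ∀ y ∈ unitBall N, 1 ≤ W y := by
    intro y hy
    have := (hsum y hy).le_tsum 0 (fun k _ => hV0 k y)
    have e : V 0 y = 1 := by simp [hV]
    rw [e] at this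
    exact this
  have hWc : ContinuousOn W (unitBall N) := by
    intro y hy
    obtain ⟨n, hn⟩ := hn y hy
    apply ContinuousAt.continuousWithinAt
    have heq : W =ᶠ[nhds y] fun z => ∑ k ∈ Finset.range (n+1), V k z := by
      filter_upwards [(isOpen_lt continuous_norm continuous_const).mem_nhds hn] with z hz
      exact tsum_eq_sum (hloc n z hz)
    apply ContinuousAt.congr _ heq.symm
    exact (continuous_finsetSum _ (fun k _ => hVc k)).continuousAt
  have hN0 : (0:ℝ) < N := by positivity
  have hpow : ∀ y, (W y ^ (2 / (N:ℝ))) ^ ((N:ℝ) / 2) = W y := by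
    intro y
    rw [← Real.rpow_mul (hW0 y), div_mul_div_cancel₀ hN0.ne', div_self two_ne_zero, Real.rpow_one]
  -- expansion of the functional
  have hexp : ∀ (g : EuclideanSpace ℝ (Fin N) → ℝ), Continuous g → (∀ y, 0 ≤ g y) → ∀ P Q : ℝ,
      (∀ k, ∫ y in unitBall N, g y * V k y ≤ (if k = 0 then P else 0) + (1/2:ℝ) ^ k * Q) →
      (∫ y in unitBall N, g y * W y) ≤ P + 2 * Q ∧
      ∀ k, ∫ y in unitBall N, g y * V k y ≤ ∫ y in unitBall N, g y * W y := by
    intro g hg hg0 P Q hPQ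
    have hnn : ∀ k, 0 ≤ ∫ y in unitBall N, g y * V k y := fun k =>
      integral_nonneg (fun y => mul_nonneg (hg0 y) (hV0 k y))
    have hhs : HasSum (fun k : ℕ => (if k = 0 then P else 0) + (1/2:ℝ) ^ k * Q) (P + 2 * Q) :=
      (hasSum_ite_eq 0 P).add (hasSum_geometric_two.mul_right Q)
    have hS : Summable (fun k => ∫ y in unitBall N, g y * V k y) :=
      Summable.of_nonneg_of_le hnn hPQ hhs.summable
    have hH := hasSum_integral_of_summable_integral_norm (F := fun k y => g y * V k y)
      (μ := volume.restrict (unitBall N))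
      (fun k => integrable_ball (hg.mul (hVc k))) (by
        convert hS using 4 with k y
        rw [Real.norm_eq_abs, abs_of_nonneg (mul_nonneg (hg0 _) (hV0 _ _))])
    have e : ∫ y in unitBall N, ∑' k, g y * V k y = ∫ y in unitBall N, g y * W y := by
      congr 1
      ext y
      exact tsum_mul_left
    rw [e] at hH
    exact ⟨hasSum_le hPQ hH hhs, fun k => le_hasSum hH k (fun j _ => hnn j)⟩
  refine ⟨fun y => W y ^ (2 / (N:ℝ)), ?_, ?_, ?_, ?_⟩
  · exact hWc.rpow_const (fun y _ => Or.inr (by positivity))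
  · intro y hy
    have := hW1 y hy
    positivity
  · refine ⟨A + 2 * 1, ?_⟩
    rintro _ ⟨u, hu, hE, rfl⟩
    simp only [hpow]
    apply (hexp (fun y => f₁ (u y)) (hc1.comp hu.1.continuous) (fun y => hpos1 _) A 1 _).1
    intro k
    by_cases hk : k = 0
    · simp only [hV, hk, if_true, mul_one, pow_zero]
      linarith [hA u hu hE]
    · simp only [hV, hk, if_false, mul_one, zero_add]
      have := hwf₁ k u hu hE
      calc ∫ y in unitBall N, f₁ (u y) * ((1/2:ℝ) ^ k * w k y) = (1/2:ℝ) ^ k * ∫ y in unitBall N, f₁ (u y) * w k y := by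
            rw [← integral_const_mul]
            congr 1
            ext y
            ring
        _ ≤ (1/2:ℝ) ^ k * 1 := by gcongr
        _ = _ := mul_one _
  · rintro ⟨b, hb⟩
    obtain ⟨k, hk⟩ := pow_unbounded_of_one_lt b (one_lt_two (α := ℝ))
    have hk1 : b < 2 ^ (k + 1) := hk.trans_le (by
      rw [pow_succ]
      have : (0:ℝ) < 2 ^ k := by positivity
      linarith)
    obtain ⟨u, hu, hE, hbig⟩ := hwf₂ (k+1)
    have hle := hb ⟨u, hu, hE, rfl⟩
    simp only [hpow] at hle
    have hcu : Continuous (fun y => f₂ (u y)) := hc2.comp hu.1.continuous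
    obtain ⟨c, hc⟩ := hu.1.continuous.bounded_above_of_compact_support hu.2.1
    have hcb : ∀ y, f₂ (u y) ≤ f₂ |c| := by
      intro y
      rw [← apply_abs_of_even heven2 (u y)]
      exact hmono2 (Set.mem_Ici.2 (abs_nonneg _)) (Set.mem_Ici.2 (abs_nonneg _)) ((hc y).trans (le_abs_self c))
    have hkey := (hexp (fun y => f₂ (u y)) hcu (fun y => hpos2 _)
      (∫ y in unitBall N, f₂ (u y)) (f₂ |c| * (1 / f₁ T₀)) (by
        intro j
        have hq : 0 ≤ f₂ |c| * (1 / f₁ T₀) := mul_nonneg (hpos2 _) (by positivity)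
        by_cases hj : j = 0
        · simp only [hV, hj, if_true, mul_one, pow_zero, one_mul]
          linarith
        · simp only [hV, hj, if_false, zero_add]
          calc ∫ y in unitBall N, f₂ (u y) * ((1/2:ℝ) ^ j * w j y) ≤ ∫ y in unitBall N, ((1/2:ℝ) ^ j * f₂ |c|) * w j y := by
                apply integral_mono (integrable_ball (hcu.mul (continuous_const.mul (hwc j)))) (integrable_ball (continuous_const.mul (hwc j)))
                intro y
                have h1 := hcb y
                have h2 := hw0 j y
                calc f₂ (u y) * ((1/2:ℝ) ^ j * w j y) ≤ f₂ |c| * ((1/2:ℝ) ^ j * w j y) := by gcongr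
                  _ = ((1/2:ℝ) ^ j * f₂ |c|) * w j y := by ring
            _ = ((1/2:ℝ) ^ j * f₂ |c|) * ∫ y in unitBall N, w j y := integral_const_mul _ _
            _ ≤ ((1/2:ℝ) ^ j * f₂ |c|) * (1 / f₁ T₀) := by
                have := hpos2 |c|
                gcongr
                exact hwi j
            _ = _ := by ring)).2 (k+1)
    have hfin : (2:ℝ) ^ (k+1) ≤ ∫ y in unitBall N, f₂ (u y) * V (k+1) y := by
      simp only [hV, Nat.succ_ne_zero, if_false]
      calc (2:ℝ) ^ (k+1) = (1/2:ℝ) ^ (k+1) * 4 ^ (k+1) := by rw [← mul_pow]; norm_num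
        _ ≤ (1/2:ℝ) ^ (k+1) * ∫ y in unitBall N, f₂ (u y) * w (k+1) y := by gcongr
        _ = _ := by
            rw [← integral_const_mul]
            congr 1
            ext y
            ring
    linarith
end

section
/- Let N ≥ 2 and p > N, and let B ⊂ ℝ^N be the open unit ball. There exists a continuous ρ : B → (0,∞) such that, for every real r ≥ N, sup { ∫_B |u(x)|^r ρ(x)^{N/2} dx : u ∈ C_c^∞(B), ∫_B |∇u(x)|^N dx ≤ 1 } < +∞ if and only if N ≤ r < p. -/
open MeasureTheory Real

abbrev EN (N : ℕ) := EuclideanSpace ℝ (Fin N)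

lemma energy_scale {N : ℕ} (v : EN N → ℝ) (x : EN N) (s : ℝ) (hs : 0 < s) :
    ∫ y, ‖fderiv ℝ (fun y => v (s • (y - x))) y‖ ^ N = ∫ y, ‖fderiv ℝ v y‖ ^ N := by
  have h1 : ∀ y, fderiv ℝ (fun y => v (s • (y - x))) y = s • fderiv ℝ v (s • (y - x)) := by
    intro y
    rw [fderiv_comp_sub (f := fun z => v (s • z)), fderiv_comp_smul]
  simp_rw [h1, norm_smul, mul_pow]
  rw [integral_sub_right_eq_self (fun y => ‖s‖ ^ N * ‖fderiv ℝ v (s • y)‖ ^ N) x]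
  rw [integral_const_mul]
  rw [Measure.integral_comp_smul_of_nonneg volume (fun y => ‖fderiv ℝ v y‖ ^ N) s (hR := hs.le)]
  simp only [finrank_euclideanSpace, Fintype.card_fin, smul_eq_mul, Real.norm_eq_abs, abs_of_pos hs]
  field_simp

lemma energy_integrable {N : ℕ} (hN : N ≠ 0) (v : EN N → ℝ) (hv : ContDiff ℝ (⊤ : ℕ∞) v)
    (hc : HasCompactSupport v) : Integrable (fun y => ‖fderiv ℝ v y‖ ^ N) := by
  refine Continuous.integrable_of_hasCompactSupport ?_ ?_
  · exact ((hv.continuous_fderiv (by simp)).norm).pow N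
  · exact (hc.fderiv (𝕜 := ℝ)).comp_left (g := fun L => ‖L‖ ^ N) (by simp [hN])

lemma compact_of_zero {N : ℕ} (v : EN N → ℝ) (x : EN N) (r : ℝ)
    (h : ∀ y, r < ‖y - x‖ → v y = 0) :
    tsupport v ⊆ Metric.closedBall x r := by
  refine closure_minimal ?_ Metric.isClosed_closedBall
  intro y hy
  by_contra hcon
  apply hy
  apply h
  simpa [dist_eq_norm] using hcon

lemma hcs_of_zero {N : ℕ} (v : EN N → ℝ) (x : EN N) (r : ℝ)
    (h : ∀ y, r < ‖y - x‖ → v y = 0) : HasCompactSupport v :=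
  (isCompact_closedBall x r).of_isClosed_subset (isClosed_tsupport v) (compact_of_zero v x r h)

lemma exists_tower (N : ℕ) (hN : N ≠ 0) : ∃ E : ℝ, 0 ≤ E ∧ ∀ n : ℕ, ∃ v : EN N → ℝ,
    ContDiff ℝ (⊤ : ℕ∞) v ∧ (∀ y, 1 < ‖y‖ → v y = 0) ∧
    ∫ y, ‖fderiv ℝ v y‖ ^ N = n * E ∧ ∃ ε > 0, ∀ y, ‖y‖ < ε → v y = n := by
  let φ : ContDiffBump (0 : EN N) := ⟨2/3, 1, by norm_num, by norm_num⟩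
  refine ⟨∫ y, ‖fderiv ℝ φ y‖ ^ N, integral_nonneg (fun y => by positivity), ?_⟩
  intro n
  induction n with
  | zero =>
    refine ⟨fun _ => 0, contDiff_const, by simp, ?_, 1, by norm_num, by simp⟩
    simp [hN]
  | succ n ih =>
    obtain ⟨v, hv, hz, hE, ε, hε, hc⟩ := ih
    set w : EN N → ℝ := fun y => v ((2:ℝ) • (y - 0)) with hw
    have hwc : ContDiff ℝ (⊤ : ℕ∞) w := by
      apply hv.comp
      fun_prop
    have hwz : ∀ y, 1/2 < ‖y - 0‖ → w y = 0 := by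
      intro y hy
      apply hz
      rw [norm_smul]
      simp only [Real.norm_ofNat]
      linarith
    have hφc : ContDiff ℝ (⊤ : ℕ∞) φ := φ.contDiff
    have hφz : ∀ y, 1 ≤ ‖y‖ → φ y = 0 := by
      intro y hy
      apply φ.zero_of_le_dist
      simpa [φ] using hy
    have hdw : ∀ y, 1/2 < ‖y‖ → fderiv ℝ w y = 0 := by
      intro y hy
      apply fderiv_of_notMem_tsupport
      intro h
      have := compact_of_zero w 0 (1/2) hwz h
      simp at this
      linarith
    have hdφ : ∀ y, ‖y‖ < 2/3 → fderiv ℝ φ y = 0 := by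
      intro y hy
      have : φ =ᶠ[nhds y] 1 := φ.eventuallyEq_one_of_mem_ball (by simpa [φ] using hy)
      rw [this.fderiv_eq]
      simp
    have hsum : ∀ y, ‖fderiv ℝ (fun y => φ y + w y) y‖ ^ N
        = ‖fderiv ℝ φ y‖ ^ N + ‖fderiv ℝ w y‖ ^ N := by
      intro y
      have : fderiv ℝ (fun y => φ y + w y) y = fderiv ℝ φ y + fderiv ℝ w y :=
        fderiv_fun_add (hφc.differentiable (by simp) y) (hwc.differentiable (by simp) y)
      rw [this]
      rcases lt_or_ge (1/2) ‖y‖ with h | h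
      · simp [hdw y h, hN]
      · simp [hdφ y (by linarith), hN]
    refine ⟨fun y => φ y + w y, hφc.add hwc, ?_, ?_, min (1/2) (ε/2), by positivity, ?_⟩
    · intro y hy
      simp only [hφz y hy.le, hwz y (by simp; linarith), add_zero]
    · simp_rw [hsum]
      rw [integral_add (energy_integrable hN _ hφc φ.hasCompactSupport)
        (energy_integrable hN _ hwc (hcs_of_zero w 0 _ hwz)), hw,
        energy_scale v 0 2 (by norm_num), hE]
      push_cast; ring
    · intro y hy
      have h1 : ‖y‖ < 1/2 := hy.trans_le (min_le_left _ _)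
      have h2 : ‖y‖ < ε/2 := hy.trans_le (min_le_right _ _)
      have h3 : φ y = 1 := φ.one_of_mem_closedBall (by simp [φ]; linarith)
      have h4 : w y = n := by
        apply hc
        rw [norm_smul]
        simp only [Real.norm_ofNat, sub_zero]
        linarith
      simp only [h3, h4]
      push_cast; ring

lemma exists_large (N : ℕ) (hN : 2 ≤ N) (x : EN N) (hx : x ∈ unitBall N) (A : ℝ) :
    ∃ u : EN N → ℝ, IsTest (unitBall N) u ∧ (∫ y in unitBall N, ‖fderiv ℝ u y‖ ^ N) ≤ 1 ∧
      ∃ ε > 0, ∀ y, ‖y - x‖ < ε → A ≤ u y := by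
  have hN0 : N ≠ 0 := by omega
  obtain ⟨E, hE0, hE⟩ := exists_tower N hN0
  obtain ⟨m, hm⟩ := exists_nat_ge (max 1 (A * (E + 1)))
  have hm1 : (1:ℝ) ≤ m := (le_max_left _ _).trans hm
  have hmA : A * (E + 1) ≤ m := (le_max_right _ _).trans hm
  obtain ⟨v, hv, hz, hvE, ε, hε, hc⟩ := hE (m ^ N)
  have hx' : ‖x‖ < 1 := by simpa [unitBall] using hx
  obtain ⟨δ, hδ, hδx⟩ : ∃ δ : ℝ, 0 < δ ∧ ‖x‖ + δ < 1 :=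
    ⟨(1 - ‖x‖)/2, by linarith, by linarith⟩
  set w : EN N → ℝ := fun y => v (δ⁻¹ • (y - x)) with hw
  have hwc : ContDiff ℝ (⊤ : ℕ∞) w := by
    apply hv.comp
    fun_prop
  set c : ℝ := (m * (E + 1))⁻¹ with hcdef
  have hc0 : 0 < c := by positivity
  have hnorm : ∀ y, ‖δ⁻¹ • (y - x)‖ = ‖y - x‖ / δ := by
    intro y
    rw [norm_smul, Real.norm_eq_abs, abs_of_pos (by positivity)]
    field_simp
  have huz : ∀ y, δ < ‖y - x‖ → c * w y = 0 := by
    intro y hy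
    have : w y = 0 := by
      apply hz
      rw [hnorm, lt_div_iff₀ hδ]
      linarith
    rw [this, mul_zero]
  have huc : ContDiff ℝ (⊤ : ℕ∞) (fun y => c * w y) := contDiff_const.mul hwc
  have hcs := hcs_of_zero _ _ _ huz
  refine ⟨fun y => c * w y, ⟨huc, hcs, ?_⟩, ?_, ε * δ, by positivity, ?_⟩
  · refine (compact_of_zero _ _ _ huz).trans ?_
    apply Metric.closedBall_subset_ball'
    simp
    linarith
  · calc (∫ y in unitBall N, ‖fderiv ℝ (fun y => c * w y) y‖ ^ N)
        ≤ ∫ y, ‖fderiv ℝ (fun y => c * w y) y‖ ^ N :=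
          setIntegral_le_integral (energy_integrable hN0 _ huc hcs)
            (Filter.Eventually.of_forall fun y => by positivity)
      _ = ∫ y, c ^ N * ‖fderiv ℝ w y‖ ^ N := by
          congr 1
          ext y
          rw [fderiv_const_mul (hwc.differentiable (by simp) y), norm_smul, mul_pow,
            Real.norm_eq_abs, abs_of_pos hc0]
      _ = c ^ N * (m ^ N * E) := by
          rw [integral_const_mul, hw, energy_scale v x _ (by positivity), hvE]
          push_cast; ring
      _ = E * ((E + 1)⁻¹) ^ N := by
          rw [hcdef, mul_inv, mul_pow, inv_pow, inv_pow]
          have : (m:ℝ) ≠ 0 := by positivity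
          field_simp
      _ ≤ E * (E + 1)⁻¹ := by
          gcongr
          apply pow_le_of_le_one (by positivity) _ hN0
          apply inv_le_one_of_one_le₀
          linarith
      _ ≤ 1 := by
          rw [← div_eq_mul_inv, div_le_one (by positivity)]
          linarith
  · intro y hy
    have : w y = ((m ^ N : ℕ) : ℝ) := by
      apply hc
      rw [hnorm, div_lt_iff₀ hδ]
      exact hy
    simp only [this]
    push_cast
    have h2 : (m:ℝ) ^ 2 ≤ (m:ℝ) ^ N := pow_le_pow_right₀ hm1 hN
    rw [hcdef, inv_mul_eq_div, le_div_iff₀ (by positivity)]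
    nlinarith

/-- Admissible competitors. -/
def Adm (N : ℕ) (u : EN N → ℝ) : Prop :=
  IsTest (unitBall N) u ∧ (∫ y in unitBall N, ‖fderiv ℝ u y‖ ^ N) ≤ 1

lemma test_integrable {N : ℕ} {u : EN N → ℝ} (hu : IsTest (unitBall N) u) {r : ℝ} (hr : 0 < r)
    {g : EN N → ℝ} (hg : ContinuousOn g (unitBall N)) :
    IntegrableOn (fun y => |u y| ^ r * g y) (unitBall N) := by
  obtain ⟨h1, h2, h3⟩ := hu
  refine Integrable.integrableOn ?_
  rw [← integrableOn_iff_integrable_of_support_subset (s := tsupport u)]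
  · apply ContinuousOn.integrableOn_compact h2
    refine ContinuousOn.mul ?_ (hg.mono h3)
    exact (h1.continuous.abs.rpow_const (fun _ => Or.inr hr.le)).continuousOn
  · intro y hy
    apply subset_tsupport
    intro h0
    apply hy
    simp [h0, Real.zero_rpow hr.ne']

lemma restrict_aux {α F : Type*} [MeasurableSpace α] [NormedAddCommGroup F] (μ : Measure α)
    (s : Set α) (f : α → F) (q : ENNReal) (h : ∀ y, y ∉ s → f y = 0) :
    eLpNorm f q (μ.restrict s) = eLpNorm f q μ := by
  apply eLpNorm_restrict_eq_of_support_subset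
  intro y hy
  by_contra hc
  exact hy (h y hc)

lemma sobolev (N : ℕ) (hN : 2 ≤ N) (q : ℝ) (hq : (N : ℝ) ≤ q) :
    ∃ C : ℝ, 0 ≤ C ∧ ∀ u : EN N → ℝ, Adm N u → (∫ y in unitBall N, |u y| ^ q) ≤ C := by
  have hN2 : (2:ℝ) ≤ N := by exact_mod_cast hN
  have hN0 : N ≠ 0 := by omega
  have hq0 : 0 < q := by linarith
  set μ : Measure (EN N) := volume.restrict (unitBall N) with hμ
  have hfin : volume (unitBall N) < ⊤ := measure_ball_lt_top
  have : IsFiniteMeasure μ := ⟨by rw [hμ, Measure.restrict_apply_univ]; exact hfin⟩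
  obtain ⟨s, hsR⟩ : ∃ s : NNReal, (s : ℝ) = q * N / (q + N) :=
    ⟨⟨q * N / (q + N), by positivity⟩, rfl⟩
  obtain ⟨q', hqR⟩ : ∃ q' : NNReal, (q' : ℝ) = q := ⟨⟨q, hq0.le⟩, rfl⟩
  have hs1 : 1 ≤ s := by
    rw [← NNReal.coe_le_coe, hsR, NNReal.coe_one, le_div_iff₀ (by positivity)]
    nlinarith
  have hsN : (s : ℝ) < N := by
    rw [hsR, div_lt_iff₀ (by positivity)]
    nlinarith
  have hsN' : s < (N : NNReal) := by exact_mod_cast hsN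
  obtain ⟨c, hcdef⟩ : ∃ c : NNReal,
    c = eLpNormLESNormFDerivOfLeConst ℝ (volume : Measure (EN N)) (unitBall N) s q' := ⟨_, rfl⟩
  obtain ⟨K, hK⟩ : ∃ K : ENNReal, K = (c : ENNReal) * (μ Set.univ) ^ (1 / (s : ℝ) - 1 / (N : ℝ)) := ⟨_, rfl⟩
  have hKtop : K ≠ ⊤ := by
    rw [hK]
    refine ENNReal.mul_ne_top ENNReal.coe_ne_top ?_
    refine ENNReal.rpow_ne_top_of_nonneg ?_ (measure_ne_top _ _)
    rw [sub_nonneg]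
    apply one_div_le_one_div_of_le _ hsN.le
    exact_mod_cast (zero_lt_one.trans_le hs1)
  refine ⟨K.toReal ^ q, by positivity, ?_⟩
  rintro u ⟨⟨h1, h2, h3⟩, hE⟩
  have hsupp : Function.support u ⊆ unitBall N := (subset_tsupport u).trans h3
  have hsuppd : ∀ y, y ∉ unitBall N → fderiv ℝ u y = 0 := fun y hy =>
    fderiv_of_notMem_tsupport ℝ (fun h => hy (h3 h))
  have hGNS := eLpNorm_le_eLpNorm_fderiv_of_le (F := ℝ) (volume : Measure (EN N))
    (h1.of_le (by simp)) hsupp (p := s) (q := q') hs1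
    (by simpa using hsN') (by
      rw [NNReal.coe_inv, hsR, hqR]
      simp only [finrank_euclideanSpace, Fintype.card_fin]
      have : (0:ℝ) < N := by linarith
      apply le_of_eq
      field_simp
      ring) Metric.isBounded_ball
  have e1 : eLpNorm u q' μ = eLpNorm u q' volume := eLpNorm_restrict_eq_of_support_subset hsupp
  have e2 : eLpNorm (fderiv ℝ u) s μ = eLpNorm (fderiv ℝ u) s volume :=
    restrict_aux _ _ _ _ hsuppd
  rw [← e1, ← e2, ← hcdef] at hGNS
  have hdcont : Continuous (fderiv ℝ u) := h1.continuous_fderiv (by simp)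
  have hHol : eLpNorm (fderiv ℝ u) s μ ≤ eLpNorm (fderiv ℝ u) N μ *
      (μ Set.univ) ^ (1 / (s : ℝ) - 1 / (N : ℝ)) := by
    have := eLpNorm_le_eLpNorm_mul_rpow_measure_univ (μ := μ) (f := fderiv ℝ u)
      (p := (s : ENNReal)) (q := (N : ENNReal)) (by exact_mod_cast hsN'.le)
      hdcont.aestronglyMeasurable
    simpa using this
  have hdL : MemLp (fderiv ℝ u) N μ :=
    (hdcont.memLp_of_hasCompactSupport (h2.fderiv (𝕜 := ℝ))).restrict _
  have hd1 : eLpNorm (fderiv ℝ u) N μ ≤ 1 := by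
    rw [hdL.eLpNorm_eq_integral_rpow_norm (by exact_mod_cast hN0) (by simp)]
    rw [ENNReal.ofReal_le_one]
    apply Real.rpow_le_one
    · exact integral_nonneg (fun y => by positivity)
    · simpa using hE
    · positivity
  have huL : MemLp u q' μ :=
    (h1.continuous.memLp_of_hasCompactSupport h2).restrict _
  have hfinal : eLpNorm u q' μ ≤ K := by
    calc eLpNorm u q' μ ≤ _ := hGNS
      _ ≤ (c : ENNReal) * (1 * (μ Set.univ) ^ (1 / (s : ℝ) - 1 / (N : ℝ))) := by
          gcongr
          exact hHol.trans (by gcongr)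
      _ = K := by rw [one_mul, hK]
  rw [huL.eLpNorm_eq_integral_rpow_norm (by
      have : 0 < q' := by rw [← NNReal.coe_pos, hqR]; exact hq0
      exact_mod_cast this.ne') (by simp)] at hfinal
  have h5 := (ENNReal.ofReal_le_iff_le_toReal hKtop).1 hfinal
  simp only [ENNReal.coe_toReal, hqR, Real.norm_eq_abs] at h5
  have h6 : 0 ≤ ∫ y in unitBall N, |u y| ^ q := integral_nonneg (fun y => by positivity)
  exact (Real.rpow_inv_le_iff_of_pos h6 (by positivity) hq0).1 h5

lemma exists_piece (N : ℕ) (hN : 2 ≤ N) (p : ℝ) (hp : (N : ℝ) < p) (k : ℕ) :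
    ∃ (η : EN N → ℝ) (T : ℝ), Continuous η ∧ (∀ y, 0 ≤ η y) ∧ (∀ y, η y ≤ 1) ∧
      (∀ y, ‖y‖ ≤ 1 - 1 / ((k : ℝ) + 1) → η y = 0) ∧ 0 < T ∧
      IntegrableOn η (unitBall N) ∧
      ((2 : ℝ) ^ k) ^ p * (∫ y in unitBall N, η y) ≤ T ∧
      (∀ u, Adm N u → ∫ y in unitBall N, |u y| ^ p * η y ≤ T) ∧
      ∃ u, Adm N u ∧ T / 2 ≤ ∫ y in unitBall N, |u y| ^ p * η y := by
  have hN2 : (2:ℝ) ≤ N := by exact_mod_cast hN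
  have hp0 : 0 < p := by linarith
  have hk1 : (0:ℝ) < (k:ℝ) + 1 := by positivity
  have hk2 : (0:ℝ) < (k:ℝ) + 2 := by positivity
  have hlt : 1 / ((k:ℝ) + 2) < 1 / ((k:ℝ) + 1) := one_div_lt_one_div_of_lt hk1 (by linarith)
  have hle1 : 1 / ((k:ℝ) + 2) < 1 := by
    rw [div_lt_one hk2]; linarith [(Nat.cast_nonneg k : (0:ℝ) ≤ k)]
  have hpos2 : 0 < 1 / ((k:ℝ) + 2) := by positivity
  let x : EN N := EuclideanSpace.single ⟨0, by omega⟩ (1 - 1 / ((k:ℝ) + 2))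
  have hx : ‖x‖ = 1 - 1 / ((k:ℝ) + 2) := by
    simp only [x, PiLp.norm_single, Real.norm_eq_abs]
    exact abs_of_nonneg (by linarith)
  obtain ⟨u₀, hu₀, hu₀E, ε, hε, hu₀A⟩ := exists_large N hN x
    (by simp only [unitBall, Metric.mem_ball, dist_zero_right, hx]; linarith) ((2:ℝ) ^ k)
  obtain ⟨d, hd0, hdε, hd1, hd2⟩ : ∃ d : ℝ, 0 < d ∧ d ≤ ε ∧
      d ≤ 1 / ((k:ℝ) + 1) - 1 / ((k:ℝ) + 2) ∧ d ≤ 1 / ((k:ℝ) + 2) :=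
    ⟨min ε (min (1 / ((k:ℝ) + 1) - 1 / ((k:ℝ) + 2)) (1 / ((k:ℝ) + 2))),
      lt_min hε (lt_min (by linarith) hpos2), min_le_left _ _,
      (min_le_right _ _).trans (min_le_left _ _), (min_le_right _ _).trans (min_le_right _ _)⟩
  let η : ContDiffBump x := ⟨d / 2, d, by positivity, by linarith⟩
  have hηsupp : ∀ y, d ≤ ‖y - x‖ → η y = 0 := fun y hy => by
    apply η.zero_of_le_dist
    rw [dist_eq_norm]; exact hy
  have hηc : Continuous η := η.continuous
  have hηint : IntegrableOn η (unitBall N) :=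
    (hηc.integrable_of_hasCompactSupport η.hasCompactSupport).integrableOn
  have hηB : ∀ y, y ∉ unitBall N → η y = 0 := by
    intro y hy
    apply hηsupp
    simp only [unitBall, Metric.mem_ball, dist_zero_right, not_lt] at hy
    have := norm_sub_norm_le y x
    linarith
  have hM : 0 < ∫ y in unitBall N, η y := by
    rw [setIntegral_eq_integral_of_forall_compl_eq_zero hηB]
    exact η.integral_pos
  set S : Set ℝ := {s | ∃ u, Adm N u ∧ s = ∫ y in unitBall N, |u y| ^ p * η y} with hS
  have hbdd : BddAbove S := by
    obtain ⟨C, hC0, hC⟩ := sobolev N hN p hp.le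
    refine ⟨C, ?_⟩
    rintro s ⟨u, hu, rfl⟩
    refine le_trans ?_ (hC u hu)
    have hi1 := test_integrable hu.1 hp0 hηc.continuousOn
    have hi2 := test_integrable hu.1 hp0 (continuousOn_const (c := (1:ℝ)))
    simp only [mul_one] at hi2
    refine integral_mono hi1 hi2 ?_
    intro y
    exact mul_le_of_le_one_right (by positivity) η.le_one
  have hu₀S : (∫ y in unitBall N, |u₀ y| ^ p * η y) ∈ S := ⟨u₀, ⟨hu₀, hu₀E⟩, rfl⟩
  have hlow : ((2 : ℝ) ^ k) ^ p * (∫ y in unitBall N, η y) ≤ sSup S := by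
    refine le_trans ?_ (le_csSup hbdd hu₀S)
    rw [← integral_const_mul]
    refine integral_mono (hηint.const_mul _) (test_integrable hu₀ hp0 hηc.continuousOn) ?_
    intro y
    rcases lt_or_ge ‖y - x‖ d with h | h
    · have h1 := hu₀A y (h.trans_le hdε)
      have h2 : (2:ℝ) ^ k ≤ |u₀ y| := h1.trans (le_abs_self _)
      have := η.nonneg (x := y)
      dsimp only
      gcongr
    · simp [hηsupp y h]
  have hT : 0 < sSup S := lt_of_lt_of_le (by positivity) hlow
  refine ⟨η, sSup S, hηc, fun y => η.nonneg, fun y => η.le_one, ?_, hT, hηint, hlow, ?_, ?_⟩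
  · intro y hy
    apply hηsupp
    have := norm_sub_norm_le x y
    rw [norm_sub_rev]
    linarith
  · intro u hu
    exact le_csSup hbdd ⟨u, hu, rfl⟩
  · obtain ⟨s, ⟨u, hu, rfl⟩, hs⟩ := exists_lt_of_lt_csSup ⟨_, hu₀S⟩ (half_lt_self hT)
    exact ⟨u, hu, hs.le⟩

/-- Elementary splitting, lower exponent. -/
lemma split_low {a b r p : ℝ} (ha : 0 ≤ a) (hb : 0 < b) (hr : 0 < r) (hrp : r < p) :
    a ^ r ≤ b ^ r + b ^ (r - p) * a ^ p := by
  rcases le_or_gt a b with h | h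
  · have h1 : a ^ r ≤ b ^ r := by gcongr
    have : 0 ≤ b ^ (r - p) * a ^ p := by positivity
    linarith
  · have ha' : 0 < a := hb.trans h
    have h1 : a ^ (r - p) ≤ b ^ (r - p) := Real.rpow_le_rpow_of_nonpos hb h.le (by linarith)
    have h2 : a ^ r = a ^ (r - p) * a ^ p := by
      rw [← Real.rpow_add ha']; congr 1; ring
    have h3 : a ^ (r - p) * a ^ p ≤ b ^ (r - p) * a ^ p := by gcongr
    have : 0 ≤ b ^ r := by positivity
    linarith

lemma split_high {a r p : ℝ} (ha : 0 ≤ a) (hp : 0 < p) (hrp : p ≤ r) :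
    a ^ p ≤ 1 + a ^ r := by
  rcases le_or_gt a 1 with h | h
  · have h1 : a ^ p ≤ 1 := Real.rpow_le_one ha h hp.le
    have : 0 ≤ a ^ r := by positivity
    linarith
  · have h1 : a ^ p ≤ a ^ r := Real.rpow_le_rpow_of_exponent_le h.le hrp
    linarith

/-- For `N ≥ 2` and `p > N` there is a conformal metric `g_ρ = ρ g_e` on the unit ball such
that, for real `r ≥ N`, the supremum of `∫_B |u|^r dV_{g_ρ}` over test functions with
Dirichlet energy at most `1` is finite if and only if `N ≤ r < p`. -/
theorem exists_metric_power_summability_up_to_p (N : ℕ) (hN : 2 ≤ N) (p : ℝ)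
    (hp : (N : ℝ) < p) :
    ∃ ρ : EuclideanSpace ℝ (Fin N) → ℝ, ContinuousOn ρ (unitBall N) ∧
      (∀ x ∈ unitBall N, 0 < ρ x) ∧
      ∀ r : ℝ, (N : ℝ) ≤ r →
        (BddAbove {s : ℝ | ∃ u : EuclideanSpace ℝ (Fin N) → ℝ, IsTest (unitBall N) u ∧
            (∫ x in unitBall N, ‖fderiv ℝ u x‖ ^ N) ≤ 1 ∧
            s = ∫ x in unitBall N, |u x| ^ r * ρ x ^ ((N : ℝ) / 2)} ↔
          ((N : ℝ) ≤ r ∧ r < p)) := by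
  have hN2 : (2:ℝ) ≤ N := by exact_mod_cast hN
  have hp0 : 0 < p := by linarith
  choose η T hηc hη0 hη1 hηz hT hηint hlow hup hex using exists_piece N hN p hp
  set a : ℕ → ℝ := fun k => k / T k with ha
  have ha0 : ∀ k, 0 ≤ a k := fun k => div_nonneg (Nat.cast_nonneg k) (hT k).le
  have haT : ∀ k, a k * T k = k := fun k => div_mul_cancel₀ _ (hT k).ne'
  set w : EN N → ℝ := fun y => 1 + ∑' k, a k * η k y with hw
  have hzero : ∀ R : ℝ, R < 1 → ∃ K : ℕ, ∀ k, K ≤ k → ∀ y : EN N, ‖y‖ < R → η k y = 0 := by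
    intro R hR
    obtain ⟨K, hK⟩ := exists_nat_one_div_lt (sub_pos.2 hR)
    refine ⟨K, fun k hk y hy => hηz k y ?_⟩
    have : 1 / ((k:ℝ) + 1) ≤ 1 / ((K:ℝ) + 1) := by
      apply one_div_le_one_div_of_le (by positivity)
      have : (K:ℝ) ≤ k := by exact_mod_cast hk
      linarith
    linarith
  have hfin : ∀ R : ℝ, R < 1 → ∃ K : ℕ, ∀ y : EN N, ‖y‖ < R →
      w y = 1 + ∑ k ∈ Finset.range K, a k * η k y := by
    intro R hR
    obtain ⟨K, hK⟩ := hzero R hR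
    refine ⟨K, fun y hy => ?_⟩
    rw [hw]
    dsimp only
    rw [tsum_eq_sum]
    intro k hk
    rw [hK k (by simpa using hk) y hy, mul_zero]
  have hmid : ∀ y ∈ unitBall N, ∃ R : ℝ, R < 1 ∧ ‖y‖ < R := by
    intro y hy
    have : ‖y‖ < 1 := by simpa [unitBall] using hy
    obtain ⟨R, h1, h2⟩ := exists_between this
    exact ⟨R, h2, h1⟩
  have hwcont : ContinuousOn w (unitBall N) := by
    intro y hy
    obtain ⟨R, hR, hyR⟩ := hmid y hy
    obtain ⟨K, hK⟩ := hfin R hR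
    apply ContinuousAt.continuousWithinAt
    have hc : Continuous (fun y => 1 + ∑ k ∈ Finset.range K, a k * η k y) :=
      continuous_const.add (continuous_finsetSum _ fun k _ => continuous_const.mul (hηc k))
    refine hc.continuousAt.congr ?_
    filter_upwards [(isOpen_lt continuous_norm continuous_const).mem_nhds hyR] with z hz
    exact (hK z hz).symm
  have hw1 : ∀ y, 1 ≤ w y := by
    intro y
    have : 0 ≤ ∑' k, a k * η k y := tsum_nonneg fun k => mul_nonneg (ha0 k) (hη0 k y)
    simp only [hw]; linarith
  have hwk : ∀ k, ∀ y ∈ unitBall N, a k * η k y ≤ w y := by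
    intro k y hy
    obtain ⟨R, hR, hyR⟩ := hmid y hy
    obtain ⟨K, hK⟩ := hzero R hR
    have hs : Summable fun k => a k * η k y := by
      refine summable_of_ne_finset_zero (s := Finset.range K) ?_
      intro j hj
      rw [hK j (by simpa using hj) y hyR, mul_zero]
    have := hs.le_tsum k (fun j _ => mul_nonneg (ha0 j) (hη0 j y))
    simp only [hw]; linarith
  refine ⟨fun y => w y ^ (2 / (N:ℝ)), ?_, ?_, ?_⟩
  · exact hwcont.rpow_const (fun y _ => Or.inr (by positivity))
  · intro y _
    exact Real.rpow_pos_of_pos (zero_lt_one.trans_le (hw1 y)) _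
  intro r hr
  have hr0 : 0 < r := by linarith
  have hρ : ∀ y, (w y ^ (2 / (N:ℝ))) ^ ((N:ℝ) / 2) = w y := by
    intro y
    rw [← Real.rpow_mul (zero_le_one.trans (hw1 y))]
    have : 2 / (N:ℝ) * ((N:ℝ) / 2) = 1 := by
      have : (N:ℝ) ≠ 0 := by positivity
      field_simp
    rw [this, Real.rpow_one]
  simp_rw [hρ]
  constructor
  · rintro ⟨b, hb⟩
    refine ⟨hr, ?_⟩
    by_contra hrp
    push Not at hrp
    obtain ⟨k, hk⟩ := exists_nat_gt (max 2 (4 * b))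
    have hk2 : (2:ℝ) < k := (le_max_left _ _).trans_lt hk
    have hkb : 4 * b < k := (le_max_right _ _).trans_lt hk
    have hk2' : 2 ≤ k := by exact_mod_cast hk2.le
    obtain ⟨u, hu, hTu⟩ := hex k
    have hM0 : 0 ≤ ∫ y in unitBall N, η k y := integral_nonneg (hη0 k)
    have hM : 4 * (∫ y in unitBall N, η k y) ≤ T k := by
      refine le_trans ?_ (hlow k)
      have h4 : (4:ℝ) ≤ 2 ^ k := by
        calc (4:ℝ) = 2 ^ 2 := by norm_num
          _ ≤ 2 ^ k := pow_le_pow_right₀ (by norm_num) hk2'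
      have : (4:ℝ) ≤ (2 ^ k) ^ p := h4.trans (Real.self_le_rpow_of_one_le (by linarith) (by linarith))
      gcongr
    have hir := test_integrable hu.1 hr0 (hηc k).continuousOn
    have hJ : (∫ y in unitBall N, |u y| ^ p * η k y) ≤
        (∫ y in unitBall N, η k y) + ∫ y in unitBall N, |u y| ^ r * η k y := by
      rw [← integral_add (hηint k) hir]
      refine integral_mono (test_integrable hu.1 hp0 (hηc k).continuousOn) ((hηint k).add hir) ?_
      intro y
      have := mul_le_mul_of_nonneg_right (split_high (abs_nonneg (u y)) hp0 hrp) (hη0 k y)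
      dsimp only
      linarith
    have hJ2 : a k * (∫ y in unitBall N, |u y| ^ r * η k y) ≤
        ∫ y in unitBall N, |u y| ^ r * w y := by
      rw [← integral_const_mul]
      refine setIntegral_mono_on (hir.const_mul _) (test_integrable hu.1 hr0 hwcont)
        Metric.isOpen_ball.measurableSet ?_
      intro y hy
      have := mul_le_mul_of_nonneg_left (hwk k y hy) (by positivity : 0 ≤ |u y| ^ r)
      linarith
    have hJ3 : a k * (T k / 4) ≤ a k * (∫ y in unitBall N, |u y| ^ r * η k y) :=
      mul_le_mul_of_nonneg_left (by linarith) (ha0 k)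
    have := hb ⟨u, hu.1, hu.2, rfl⟩
    have := haT k
    linarith
  · rintro ⟨-, hrp⟩
    obtain ⟨C, hC0, hC⟩ := sobolev N hN r hr
    set q : ℝ := (2:ℝ) ^ (r - p) with hq
    have hq0 : 0 < q := by positivity
    have hq1 : q < 1 := Real.rpow_lt_one_of_one_lt_of_neg (by norm_num) (by linarith)
    have hsum : Summable fun k : ℕ => 2 * ((k:ℝ) * q ^ k) := by
      have := summable_pow_mul_geometric_of_norm_lt_one (R := ℝ) 1 (r := q)
        (by rwa [Real.norm_eq_abs, abs_of_pos hq0])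
      simp only [pow_one] at this
      exact this.mul_left 2
    refine ⟨C + ∑' k : ℕ, 2 * ((k:ℝ) * q ^ k), ?_⟩
    rintro s ⟨u, hu, hE, rfl⟩
    obtain ⟨R, hR, hRu⟩ := exists_lt_subset_ball (isClosed_tsupport u) hu.2.2
    obtain ⟨K, hK⟩ := hfin R hR
    have hpt : ∀ y, |u y| ^ r * w y
        = |u y| ^ r + ∑ k ∈ Finset.range K, a k * (|u y| ^ r * η k y) := by
      intro y
      by_cases hy : y ∈ tsupport u
      · have : ‖y‖ < R := by simpa using hRu hy
        rw [hK y this, mul_add, mul_one, Finset.mul_sum]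
        congr 1
        refine Finset.sum_congr rfl fun k _ => ?_
        ring
      · have : u y = 0 := image_eq_zero_of_notMem_tsupport hy
        simp [this, Real.zero_rpow hr0.ne']
    have hir : ∀ k, IntegrableOn (fun y => |u y| ^ r * η k y) (unitBall N) := fun k =>
      test_integrable hu hr0 (hηc k).continuousOn
    have hi2 := test_integrable hu hr0 (continuousOn_const (c := (1:ℝ)))
    simp only [mul_one] at hi2
    have hterm : ∀ k, a k * (∫ y in unitBall N, |u y| ^ r * η k y) ≤ 2 * ((k:ℝ) * q ^ k) := by
      intro k
      have hb : (0:ℝ) < 2 ^ k := by positivity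
      have hqk : ((2:ℝ) ^ k) ^ (r - p) = q ^ k := by
        rw [hq, ← Real.rpow_natCast, ← Real.rpow_natCast, ← Real.rpow_mul (by norm_num),
          ← Real.rpow_mul (by norm_num), mul_comm]
      have hbr : ((2:ℝ) ^ k) ^ r = q ^ k * ((2:ℝ) ^ k) ^ p := by
        rw [← hqk, ← Real.rpow_add hb]; congr 1; ring
      have hip := test_integrable hu hp0 (hηc k).continuousOn
      have hJ : (∫ y in unitBall N, |u y| ^ r * η k y) ≤
          ((2:ℝ) ^ k) ^ r * (∫ y in unitBall N, η k y)
            + q ^ k * ∫ y in unitBall N, |u y| ^ p * η k y := by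
        rw [← integral_const_mul, ← integral_const_mul,
          ← integral_add ((hηint k).const_mul _) (hip.const_mul _)]
        refine integral_mono (hir k) (((hηint k).const_mul _).add (hip.const_mul _)) ?_
        intro y
        have := mul_le_mul_of_nonneg_right (split_low (abs_nonneg (u y)) hb hr0 hrp) (hη0 k y)
        rw [hqk] at this
        dsimp only
        linarith
      have hJ2 : (∫ y in unitBall N, |u y| ^ r * η k y) ≤ 2 * q ^ k * T k := by
        have h1 := mul_le_mul_of_nonneg_left (hlow k) (by positivity : 0 ≤ q ^ k)
        have h2 := mul_le_mul_of_nonneg_left (hup k u ⟨hu, hE⟩) (by positivity : 0 ≤ q ^ k)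
        rw [hbr] at hJ
        linarith
      calc a k * (∫ y in unitBall N, |u y| ^ r * η k y) ≤ a k * (2 * q ^ k * T k) :=
            mul_le_mul_of_nonneg_left hJ2 (ha0 k)
        _ = 2 * q ^ k * (a k * T k) := by ring
        _ = 2 * ((k:ℝ) * q ^ k) := by rw [haT]; ring
    simp_rw [hpt]
    rw [integral_add hi2 (integrable_finsetSum _ fun k _ => (hir k).const_mul _),
      integral_finsetSum _ fun k _ => (hir k).const_mul _]
    simp_rw [integral_const_mul]
    refine add_le_add (hC u ⟨hu, hE⟩) ?_
    refine (Finset.sum_le_sum fun k _ => hterm k).trans ?_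
    exact hsum.sum_le_tsum _ fun k _ => by positivity
end

section
/- Let Ω := ℝ × (−1,1) ⊂ ℝ² and let u : ℝ² → ℝ be locally Lipschitz with u = 0 outside Ω, ∫_Ω u(x)² dx < ∞ and ∫_Ω |∇u(x)|² dx < ∞ (the gradient being defined almost everywhere by Rademacher's theorem). Then for every α > 0, ∫_Ω ( e^{α u(x)²} − 1 ) dx < +∞. -/
open MeasureTheory Real

/-- The infinite planar strip `Ω = ℝ × (-1,1) ⊂ ℝ²`. -/
def strip : Set (EuclideanSpace ℝ (Fin 2)) := {x | x 1 ∈ Set.Ioo (-1 : ℝ) 1}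

theorem trunc_deriv_le (f : ℝ → ℝ) (hf : Continuous f) (s t : ℝ) (hs : 0 ≤ s) (hst : s < t) (x : ℝ) :
    ‖deriv (fun x => max s (min t |f x|)) x‖ₑ ≤
      ({x | s < |f x| ∧ |f x| < t}.indicator (fun x => ‖deriv f x‖ₑ) x) := by
  by_cases hx : s < |f x| ∧ |f x| < t
  · rw [Set.indicator_of_mem (by exact hx)]
    have hev : ∀ᶠ y in nhds x, s < |f y| ∧ |f y| < t := by
      have h1 : IsOpen {y | s < |f y| ∧ |f y| < t} :=
        (isOpen_lt continuous_const hf.abs).inter (isOpen_lt hf.abs continuous_const)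
      exact h1.mem_nhds hx
    have hne : f x ≠ 0 := by
      intro h
      rw [h] at hx
      simp at hx
      linarith
    rcases lt_or_gt_of_ne hne with h | h
    · have : (fun x => max s (min t |f x|)) =ᶠ[nhds x] (fun x => - f x) := by
        filter_upwards [hev, hf.continuousAt.eventually (gt_mem_nhds h)] with y hy hy0
        rw [min_eq_right hy.2.le, max_eq_right hy.1.le, abs_of_neg hy0]
      rw [this.deriv_eq, deriv.fun_neg]
      simp
    · have : (fun x => max s (min t |f x|)) =ᶠ[nhds x] f := by
        filter_upwards [hev, hf.continuousAt.eventually (lt_mem_nhds h)] with y hy hy0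
        rw [min_eq_right hy.2.le, max_eq_right hy.1.le, abs_of_pos hy0]
      rw [this.deriv_eq]
  · have : deriv (fun x => max s (min t |f x|)) x = 0 := by
      by_cases h1 : |f x| ≤ s
      · apply IsLocalMin.deriv_eq_zero
        refine Filter.Eventually.of_forall fun y => ?_
        simp only
        rw [min_eq_right (by linarith), max_eq_left h1]
        exact le_max_left _ _
      · apply IsLocalMax.deriv_eq_zero
        refine Filter.Eventually.of_forall fun y => ?_
        have : t ≤ |f x| := by
          by_contra h
          exact hx ⟨not_le.1 h1, not_le.1 h⟩
        simp only
        rw [min_eq_left this, max_eq_right hst.le]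
        exact max_le hst.le (min_le_left _ _)
    rw [this]
    simp

theorem one_dim (f : ℝ → ℝ) (hf : LocallyLipschitz f) (s t : ℝ) (hs : 0 ≤ s) (hst : s < t)
    (a b : ℝ) (ha : |f a| ≤ s) (hb : t ≤ |f b|) :
    ENNReal.ofReal (t - s) ≤
      ∫⁻ x, {x | s < |f x| ∧ |f x| < t}.indicator (fun x => ‖deriv f x‖ₑ) x := by
  set T : ℝ → ℝ := fun x => max s (min t |f x|) with hT
  have habs : LocallyLipschitz (fun x => |f x|) := by
    have := (lipschitzWith_one_norm (E := ℝ)).locallyLipschitz.comp hf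
    exact this
  have hTl : LocallyLipschitz T := (habs.const_min t).const_max s
  obtain ⟨K, hK⟩ := (hTl.locallyLipschitzOn (s := Set.uIcc a b)).exists_lipschitzOnWith_of_compact
    isCompact_uIcc
  have hac := hK.absolutelyContinuousOnInterval
  have hftc := hac.integral_deriv_eq_sub
  have hTa : T a = s := by
    simp only [hT]
    rw [min_eq_right (by linarith), max_eq_left ha]
  have hTb : T b = t := by
    simp only [hT]
    rw [min_eq_left hb, max_eq_right hst.le]
  rw [hTa, hTb] at hftc
  calc ENNReal.ofReal (t - s) ≤ ‖t - s‖ₑ := by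
        rw [Real.enorm_eq_ofReal_abs]
        exact ENNReal.ofReal_le_ofReal (le_abs_self _)
    _ = ‖∫ x in Set.uIoc a b, deriv T x‖ₑ := by
        rw [← hftc, ← ofReal_norm, intervalIntegral.norm_intervalIntegral_eq, ofReal_norm]
    _ ≤ ∫⁻ x in Set.uIoc a b, ‖deriv T x‖ₑ := enorm_integral_le_lintegral_enorm _
    _ ≤ ∫⁻ x, ‖deriv T x‖ₑ := setLIntegral_le_lintegral _ _
    _ ≤ _ := lintegral_mono fun x => trunc_deriv_le f hf.continuous s t hs hst x

/-- The Euclidean plane. -/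
abbrev E2 := EuclideanSpace ℝ (Fin 2)

noncomputable def mk2 (p : ℝ × ℝ) : E2 := !₂[p.1, p.2]

theorem mk2_mp : MeasurePreserving mk2 (volume.prod volume) volume := by
  have h1 := (EuclideanSpace.volume_preserving_symm_measurableEquiv_toLp (Fin 2)).symm
  have h2 := (volume_preserving_finTwoArrow ℝ).symm
  exact h1.comp h2

theorem mk2_cont : Continuous mk2 := by
  unfold mk2
  fun_prop

theorem loclip_ae_diff (u : E2 → ℝ) (hu : LocallyLipschitz u) : ∀ᵐ x, DifferentiableAt ℝ u x := by
  rw [ae_iff]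
  apply measure_null_of_locally_null
  intro x hx
  obtain ⟨K, t, ht, hK⟩ := hu x
  obtain ⟨v, hvt, hvo, hxv⟩ := mem_nhds_iff.1 ht
  refine ⟨_ ∩ v, inter_mem_nhdsWithin _ (hvo.mem_nhds hxv), ?_⟩
  have := (hK.mono hvt).ae_differentiableWithinAt_of_mem (μ := volume)
  rw [ae_iff] at this
  refine measure_mono_null ?_ this
  rintro y ⟨hy, hyv⟩ h
  exact hy ((h hyv).differentiableAt (hvo.mem_nhds hyv))

theorem slice_x (u : E2 → ℝ) (hu : LocallyLipschitz u) (y : ℝ) :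
    LocallyLipschitz (fun x => u (mk2 (x, y))) := by
  refine hu.comp (g := fun x : ℝ => mk2 (x,y)) ?_
  apply ContDiff.locallyLipschitz (𝕂 := ℝ)
  unfold mk2
  rw [contDiff_euclidean]
  intro i
  fin_cases i <;> simp <;> fun_prop

theorem slice_y (u : E2 → ℝ) (hu : LocallyLipschitz u) (x : ℝ) :
    LocallyLipschitz (fun y => u (mk2 (x, y))) := by
  refine hu.comp (g := fun y : ℝ => mk2 (x,y)) ?_
  apply ContDiff.locallyLipschitz (𝕂 := ℝ)
  unfold mk2
  rw [contDiff_euclidean]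
  intro i
  fin_cases i <;> simp <;> fun_prop

theorem deriv_x (u : E2 → ℝ) (x y : ℝ) (h : DifferentiableAt ℝ u (mk2 (x,y))) :
    ‖deriv (fun x => u (mk2 (x, y))) x‖ₑ ≤ ‖fderiv ℝ u (mk2 (x,y))‖ₑ := by
  have h1 : HasDerivAt (fun x : ℝ => mk2 (x,y)) (!₂[1,0]) x := by
    have : (fun x : ℝ => mk2 (x,y)) = fun x : ℝ => x • (!₂[1,0] : E2) + !₂[0,y] := by
      ext z i
      fin_cases i <;> simp [mk2]
    rw [this]
    simpa using ((hasDerivAt_id x).smul_const (!₂[1,0] : E2)).add_const (!₂[0,y] : E2)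
  have h2 := h.hasFDerivAt.comp_hasDerivAt x h1
  have h3 : deriv (fun x => u (mk2 (x, y))) x = _ := h2.deriv
  rw [h3, ← ofReal_norm, ← ofReal_norm]
  apply ENNReal.ofReal_le_ofReal
  refine ((fderiv ℝ u (mk2 (x,y))).le_opNorm _).trans ?_
  simp [EuclideanSpace.norm_eq]

theorem deriv_y (u : E2 → ℝ) (x y : ℝ) (h : DifferentiableAt ℝ u (mk2 (x,y))) :
    ‖deriv (fun y => u (mk2 (x, y))) y‖ₑ ≤ ‖fderiv ℝ u (mk2 (x,y))‖ₑ := by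
  have h1 : HasDerivAt (fun y : ℝ => mk2 (x,y)) (!₂[0,1]) y := by
    have : (fun y : ℝ => mk2 (x,y)) = fun y : ℝ => y • (!₂[0,1] : E2) + !₂[x,0] := by
      ext z i
      fin_cases i <;> simp [mk2]
    rw [this]
    simpa using ((hasDerivAt_id y).smul_const (!₂[0,1] : E2)).add_const (!₂[x,0] : E2)
  have h2 := h.hasFDerivAt.comp_hasDerivAt y h1
  have h3 : deriv (fun y => u (mk2 (x, y))) y = _ := h2.deriv
  rw [h3, ← ofReal_norm, ← ofReal_norm]
  apply ENNReal.ofReal_le_ofReal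
  refine ((fderiv ℝ u (mk2 (x,y))).le_opNorm _).trans ?_
  simp [EuclideanSpace.norm_eq]

theorem key2d (u : E2 → ℝ) (hu : LocallyLipschitz u) (hzero : ∀ x, x ∉ strip → u x = 0)
    (s t : ℝ) (hs : 0 ≤ s) (hst : s < t) (hfin : volume {x | s < |u x|} ≠ ⊤) :
    ENNReal.ofReal (t - s) ^ 2 * volume {x | t ≤ |u x|} ≤
      (∫⁻ x in {x | s < |u x| ∧ |u x| < t}, ‖fderiv ℝ u x‖ₑ) ^ 2 := by
  have hc := hu.continuous
  set D : Set E2 := {x | s < |u x| ∧ |u x| < t} with hD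
  have hDm : MeasurableSet D :=
    ((isOpen_lt continuous_const hc.abs).inter (isOpen_lt hc.abs continuous_const)).measurableSet
  have hAm : MeasurableSet {x | t ≤ |u x|} := (isClosed_le continuous_const hc.abs).measurableSet
  have hSm : MeasurableSet {x | s < |u x|} := (isOpen_lt continuous_const hc.abs).measurableSet
  set g : E2 → ENNReal := D.indicator (fun x => ‖fderiv ℝ u x‖ₑ) with hg
  have hgm : Measurable g := (measurable_fderiv ℝ u).enorm.indicator hDm
  have hGm : Measurable (fun p : ℝ × ℝ => g (mk2 p)) := hgm.comp mk2_cont.measurable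
  have hdiff : ∀ᵐ p ∂((volume : Measure ℝ).prod (volume : Measure ℝ)), DifferentiableAt ℝ u (mk2 p) :=
    mk2_mp.quasiMeasurePreserving.ae (loclip_ae_diff u hu)
  have hdiff1 : ∀ᵐ x : ℝ, ∀ᵐ y : ℝ, DifferentiableAt ℝ u (mk2 (x, y)) :=
    Measure.ae_ae_of_ae_prod hdiff
  have hdiff2 : ∀ᵐ y : ℝ, ∀ᵐ x : ℝ, DifferentiableAt ℝ u (mk2 (x, y)) := by
    have := (Measure.measurePreserving_swap (μ := (volume : Measure ℝ))
      (ν := (volume : Measure ℝ))).quasiMeasurePreserving.ae hdiff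
    exact Measure.ae_ae_of_ae_prod this
  have hfin2 : ∀ᵐ y : ℝ, volume {x : ℝ | s < |u (mk2 (x, y))|} < ⊤ := by
    have hmp := mk2_mp.comp (Measure.measurePreserving_swap (μ := (volume : Measure ℝ))
      (ν := (volume : Measure ℝ)))
    have h1 := hmp.measure_preimage hSm.nullMeasurableSet
    have h2 := Measure.ae_measure_lt_top (hmp.measurable hSm) (by rw [h1]; exact hfin)
    exact h2
  have hX : ∀ᵐ x : ℝ, ∀ y, t ≤ |u (mk2 (x, y))| →
      ENNReal.ofReal (t - s) ≤ ∫⁻ y', g (mk2 (x, y')) := by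
    filter_upwards [hdiff1] with x hx y hy
    refine (one_dim _ (slice_y u hu x) s t hs hst (-1) y ?_ hy).trans ?_
    · rw [hzero]
      · simpa using hs
      · simp [strip, mk2]
    · refine lintegral_mono_ae ?_
      filter_upwards [hx] with z hz
      by_cases hzD : mk2 (x, z) ∈ D
      · rw [hg, Set.indicator_of_mem hzD, Set.indicator_of_mem (by exact hzD)]
        exact deriv_y u x z hz
      · rw [Set.indicator_of_notMem (by exact hzD)]
        exact zero_le
  have hY : ∀ᵐ y : ℝ, ∀ x, t ≤ |u (mk2 (x, y))| →
      ENNReal.ofReal (t - s) ≤ ∫⁻ x', g (mk2 (x', y)) := by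
    filter_upwards [hdiff2, hfin2] with y hy hf x hx
    obtain ⟨a, ha⟩ : ∃ a, |u (mk2 (a, y))| ≤ s := by
      by_contra! hcon
      have : {x : ℝ | s < |u (mk2 (x, y))|} = Set.univ := Set.eq_univ_of_forall hcon
      rw [this] at hf
      simp at hf
    refine (one_dim _ (slice_x u hu y) s t hs hst a x ha hx).trans ?_
    refine lintegral_mono_ae ?_
    filter_upwards [hy] with z hz
    by_cases hzD : mk2 (z, y) ∈ D
    · rw [hg, Set.indicator_of_mem hzD, Set.indicator_of_mem (by exact hzD)]
      exact deriv_x u z y hz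
    · rw [Set.indicator_of_notMem (by exact hzD)]
      exact zero_le
  have hprod : ∀ᵐ p ∂((volume : Measure ℝ).prod (volume : Measure ℝ)),
      (mk2 ⁻¹' {x | t ≤ |u x|}).indicator (fun _ => ENNReal.ofReal (t - s) ^ 2) p ≤
        (∫⁻ y', g (mk2 (p.1, y'))) * (∫⁻ x', g (mk2 (x', p.2))) := by
    filter_upwards [Measure.quasiMeasurePreserving_fst.ae hX,
      Measure.quasiMeasurePreserving_snd.ae hY] with p h1 h2
    by_cases hp : p ∈ mk2 ⁻¹' {x | t ≤ |u x|}
    · rw [Set.indicator_of_mem hp, pow_two]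
      exact mul_le_mul' (h1 p.2 hp) (h2 p.1 hp)
    · rw [Set.indicator_of_notMem hp]
      exact zero_le
  have hI := lintegral_mono_ae hprod
  rw [lintegral_indicator (mk2_cont.measurable hAm), lintegral_const, Measure.restrict_apply_univ,
    mk2_mp.measure_preimage hAm.nullMeasurableSet,
    lintegral_prod_mul (hGm.lintegral_prod_right' (ν := volume)).aemeasurable
      (hGm.lintegral_prod_left' (μ := volume)).aemeasurable,
    ← lintegral_prod _ hGm.aemeasurable, ← lintegral_prod_symm _ hGm.aemeasurable,
    mk2_mp.lintegral_comp hgm, hg, lintegral_indicator hDm, ← pow_two] at hI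
  exact hI

theorem cs (μ : Measure E2) (f : E2 → ENNReal) (hf : Measurable f) :
    (∫⁻ x, f x ∂μ) ^ 2 ≤ μ Set.univ * ∫⁻ x, f x ^ 2 ∂μ := by
  have h := ENNReal.lintegral_mul_le_Lp_mul_Lq μ Real.HolderConjugate.two_two
    (f := fun _ => 1) (g := f) aemeasurable_const hf.aemeasurable
  simp only [Pi.mul_apply, one_mul, ENNReal.one_rpow, lintegral_const] at h
  calc _ ≤ _ := pow_le_pow_left' h 2
    _ = _ := by
      rw [mul_pow, ← ENNReal.rpow_natCast, ← ENNReal.rpow_natCast, ← ENNReal.rpow_mul,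
        ← ENNReal.rpow_mul]
      norm_num

theorem key (u : E2 → ℝ) (hu : LocallyLipschitz u) (hzero : ∀ x, x ∉ strip → u x = 0)
    (s t : ℝ) (hs : 0 ≤ s) (hst : s < t) (hfin : volume {x | s ≤ |u x|} ≠ ⊤) :
    ENNReal.ofReal (t - s) ^ 2 * volume {x | t ≤ |u x|} ≤
      volume {x | s ≤ |u x|} * ∫⁻ x in {x | s < |u x| ∧ |u x| < t}, ‖fderiv ℝ u x‖ₑ ^ 2 := by
  refine (key2d u hu hzero s t hs hst
    (ne_top_of_le_ne_top hfin (measure_mono (Set.ofPred_subset_ofPred.2 fun x hx => hx.le)))).trans ?_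
  refine (cs _ _ (measurable_fderiv ℝ u).enorm).trans ?_
  rw [Measure.restrict_apply_univ]
  refine mul_le_mul_left ?_ _
  exact measure_mono fun x hx => hx.1.le

theorem amgm (J : ℕ) (hJ : 0 < J) (e : ℕ → ℝ) (he : ∀ i, 0 ≤ e i) :
    ∏ i ∈ Finset.range J, e i ≤ ((∑ i ∈ Finset.range J, e i) / J) ^ J := by
  have h := Real.geom_mean_le_arith_mean (Finset.range J) (fun _ => 1) e (by simp) (by simpa)
    (fun i _ => he i)
  simp at h
  have hp : 0 ≤ ∏ i ∈ Finset.range J, e i := Finset.prod_nonneg fun i _ => he i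
  calc _ = ((∏ i ∈ Finset.range J, e i) ^ ((J : ℝ)⁻¹)) ^ J := by
        rw [Real.rpow_inv_natCast_pow hp hJ.ne']
    _ ≤ _ := pow_le_pow_left₀ (by positivity) h _

theorem iter (u : E2 → ℝ) (hu : LocallyLipschitz u) (hzero : ∀ x, x ∉ strip → u x = 0)
    (m h ε : ℝ) (hm : 0 ≤ m) (hh : 0 < h) (hfin : volume {x | m ≤ |u x|} ≠ ⊤)
    (hE : ∫⁻ x in {x | m ≤ |u x|}, ‖fderiv ℝ u x‖ₑ ^ 2 ≤ ENNReal.ofReal ε) (hε : 0 ≤ ε)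
    (J : ℕ) (hJ : 0 < J) :
    (volume {x | m + J * h ≤ |u x|}).toReal ≤
      (volume {x | m ≤ |u x|}).toReal * (ε / (J * h ^ 2)) ^ J := by
  have hc := hu.continuous
  set μ : ℕ → ℝ := fun j => (volume {x | m + j * h ≤ |u x|}).toReal with hμ
  set D : ℕ → Set E2 := fun j => {x | m + j * h < |u x| ∧ |u x| < m + (j+1) * h} with hD
  have hDm : ∀ j, MeasurableSet (D j) := fun j =>
    ((isOpen_lt continuous_const hc.abs).inter (isOpen_lt hc.abs continuous_const)).measurableSet
  set e' : ℕ → ENNReal := fun j => ∫⁻ x in D j, ‖fderiv ℝ u x‖ₑ ^ 2 with he'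
  set e : ℕ → ℝ := fun j => (e' j).toReal with he
  have hdisj : ∀ i j, i < j → Disjoint (D i) (D j) := by
    intro i j hij
    rw [Set.disjoint_left]
    rintro x ⟨_, h1⟩ ⟨h2, _⟩
    have : (i : ℝ) + 1 ≤ j := by exact_mod_cast hij
    nlinarith
  have hpd : Pairwise (Function.onFun Disjoint D) := by
    intro i j hij
    rcases lt_or_gt_of_ne hij with h | h
    · exact hdisj _ _ h
    · exact (hdisj _ _ h).symm
  have hsum' : ∑ j ∈ Finset.range J, e' j ≤ ENNReal.ofReal ε := by
    rw [he', ← lintegral_biUnion_finset (fun i _ j _ hij => hpd hij) (fun j _ => hDm j)]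
    refine (lintegral_mono_set ?_).trans hE
    intro x hx
    simp only [Set.mem_iUnion] at hx
    obtain ⟨j, _, hx⟩ := hx
    have h1 := hx.1
    have : 0 ≤ j * h := by positivity
    show m ≤ |u x|
    linarith
  have hefin : ∀ j ∈ Finset.range J, e' j ≠ ⊤ := fun j hj =>
    ne_top_of_le_ne_top ENNReal.ofReal_ne_top ((Finset.single_le_sum (fun _ _ => zero_le) hj).trans hsum')
  have hsum : ∑ j ∈ Finset.range J, e j ≤ ε := by
    rw [he, ← ENNReal.toReal_sum hefin]
    exact ENNReal.toReal_le_of_le_ofReal hε hsum'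
  have hvfin : ∀ j : ℕ, volume {x | m + j * h ≤ |u x|} ≠ ⊤ := fun j => by
    refine ne_top_of_le_ne_top hfin (measure_mono ?_)
    intro x hx
    have : 0 ≤ j * h := by positivity
    have hx : m + j * h ≤ |u x| := hx
    show m ≤ |u x|
    linarith
  have hstep : ∀ j, j < J → h ^ 2 * μ (j+1) ≤ μ j * e j := by
    intro j hj
    have hk := key u hu hzero (m + j * h) (m + (j+1) * h) (by positivity) (by nlinarith) (hvfin j)
    have hk2 := ENNReal.toReal_mono (ENNReal.mul_ne_top (hvfin j) (hefin j (by simpa using hj))) hk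
    rw [ENNReal.toReal_mul, ENNReal.toReal_mul, ENNReal.toReal_pow, ENNReal.toReal_ofReal (by nlinarith)] at hk2
    have : m + (j+1) * h - (m + j * h) = h := by ring
    rw [this] at hk2
    simp only [hμ]
    push_cast
    exact hk2
  have hit : ∀ j, j ≤ J → (h ^ 2) ^ j * μ j ≤ μ 0 * ∏ i ∈ Finset.range j, e i := by
    intro j
    induction j with
    | zero => simp
    | succ j ih =>
      intro hj
      have h1 := ih (by omega)
      have h2 := hstep j (by omega)
      rw [Finset.prod_range_succ]
      calc (h^2)^(j+1) * μ (j+1) = (h^2)^j * (h^2 * μ (j+1)) := by ring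
        _ ≤ (h^2)^j * (μ j * e j) := by gcongr
        _ = ((h^2)^j * μ j) * e j := by ring
        _ ≤ (μ 0 * ∏ i ∈ Finset.range j, e i) * e j := by
          gcongr
        _ = _ := by ring
  have hfinal := hit J le_rfl
  have hprod : ∏ i ∈ Finset.range J, e i ≤ (ε / J) ^ J := by
    refine (amgm J hJ e fun i => ENNReal.toReal_nonneg).trans ?_
    have : 0 ≤ ∑ i ∈ Finset.range J, e i := Finset.sum_nonneg fun i _ => ENNReal.toReal_nonneg
    gcongr
  have hμ0 : μ 0 = (volume {x | m ≤ |u x|}).toReal := by simp [hμ]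
  rw [← hμ0]
  show μ J ≤ _
  have h0 : 0 ≤ μ 0 := ENNReal.toReal_nonneg
  have hJ' : (0:ℝ) < J := by exact_mod_cast hJ
  have : (ε / (J * h ^ 2)) ^ J = (ε / J) ^ J / (h^2)^J := by
    rw [← div_pow, div_div]
  rw [this, ← mul_div_assoc, le_div_iff₀ (by positivity), mul_comm]
  exact hfinal.trans (by gcongr)

theorem strip_exp_integrable (u : EuclideanSpace ℝ (Fin 2) → ℝ)
    (hlip : LocallyLipschitz u)
    (hzero : ∀ x, x ∉ strip → u x = 0)
    (hL2 : IntegrableOn (fun x => u x ^ 2) strip)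
    (hE : IntegrableOn (fun x => ‖fderiv ℝ u x‖ ^ 2) strip) :
    ∀ α : ℝ, 0 < α →
      IntegrableOn (fun x => Real.exp (α * u x ^ 2) - 1) strip := by
  intro α hα
  have hc := hlip.continuous
  have hSm : ∀ s : ℝ, MeasurableSet {x | s ≤ |u x|} := fun s =>
    (isClosed_le continuous_const hc.abs).measurableSet
  have hSsub : ∀ s : ℝ, 0 < s → {x | s ≤ |u x|} ⊆ strip := by
    intro s hs x hx
    by_contra h
    have hx : s ≤ |u x| := hx
    rw [hzero x h] at hx
    simp at hx
    linarith
  have hres : ∀ s : ℝ, 0 < s → (volume.restrict strip) {x | s ≤ |u x|} = volume {x | s ≤ |u x|} := by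
    intro s hs
    rw [Measure.restrict_apply (hSm s), Set.inter_eq_left.2 (hSsub s hs)]
  have hfin : ∀ s : ℝ, 0 < s → volume {x | s ≤ |u x|} ≠ ⊤ := by
    intro s hs
    have := Integrable.measure_norm_ge_lt_top hL2 (ε := s ^ 2) (by positivity)
    rw [← hres s hs]
    refine ne_top_of_le_ne_top this.ne (measure_mono ?_)
    intro x hx
    have hx : s ≤ |u x| := hx
    show s ^ 2 ≤ ‖u x ^ 2‖
    rw [norm_pow, Real.norm_eq_abs]
    gcongr
  have hEfin : ∫⁻ x in strip, ‖fderiv ℝ u x‖ₑ ^ 2 ≠ ⊤ := by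
    have h := hE.2.ne
    simpa using h
  have hvt : Filter.Tendsto (fun n : ℕ => (volume.restrict strip) {x | ((n:ℝ) + 1) ≤ |u x|})
      Filter.atTop (nhds 0) := by
    have h := tendsto_measure_iInter_atTop (μ := volume.restrict strip)
      (s := fun n : ℕ => {x | ((n:ℝ) + 1) ≤ |u x|}) (fun n => (hSm _).nullMeasurableSet)
      (by
        intro i j hij x hx
        have hx : (j:ℝ) + 1 ≤ |u x| := hx
        have : (i:ℝ) ≤ j := by exact_mod_cast hij
        show (i:ℝ) + 1 ≤ |u x|
        linarith)
      ⟨0, by rw [hres _ (by positivity)]; exact hfin _ (by positivity)⟩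
    have h0 : (⋂ n : ℕ, {x | ((n:ℝ) + 1) ≤ |u x|}) = ∅ := by
      rw [Set.eq_empty_iff_forall_notMem]
      intro x hx
      obtain ⟨n, hn⟩ := exists_nat_gt |u x|
      have : (n:ℝ) + 1 ≤ |u x| := Set.mem_iInter.1 hx n
      linarith
    rw [h0, measure_empty] at h
    exact h
  have hEt := tendsto_setLIntegral_zero hEfin hvt
  obtain ⟨N, hN⟩ := exists_nat_ge (2 * α + 1)
  have hN0 : (0:ℝ) < N := by linarith
  set ε : ℝ := Real.exp (-1) / N with hε
  have hεp : 0 < ε := by positivity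
  obtain ⟨k, hk⟩ := (hEt.eventually (gt_mem_nhds (ENNReal.ofReal_pos.2 hεp))).exists
  set m : ℝ := (k:ℝ) + 1 with hm
  have hm0 : 0 < m := by positivity
  have hEm : ∫⁻ x in {x | m ≤ |u x|}, ‖fderiv ℝ u x‖ₑ ^ 2 ≤ ENNReal.ofReal ε := by
    rw [Measure.restrict_restrict (hSm _), Set.inter_eq_left.2 (hSsub m hm0)] at hk
    exact hk.le
  set M : ℝ := (volume {x | m ≤ |u x|}).toReal with hM
  have hM0 : 0 ≤ M := ENNReal.toReal_nonneg
  have hdecay : ∀ n : ℕ, (volume {x | m + n ≤ |u x|}).toReal ≤ M * Real.exp (-(N * n ^ 2)) := by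
    intro n
    rcases Nat.eq_zero_or_pos n with rfl | hn
    · simp [hM]
    have hn' : (0:ℝ) < n := by exact_mod_cast hn
    have hNn : 0 < N := by exact_mod_cast hN0
    have h := iter u hlip hzero m (1 / (N * n)) ε hm0.le (by positivity) (hfin m hm0) hEm hεp.le
      (N * n ^ 2) (by positivity)
    push_cast at h
    have h1 : (N:ℝ) * n ^ 2 * (1 / (N * n)) = n := by field_simp
    have h2 : ε / (N * n ^ 2 * (1 / (N * n)) ^ 2) = Real.exp (-1) := by
      rw [hε]; field_simp
    rw [h1, h2, ← Real.exp_nat_mul] at h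
    push_cast at h
    have h3 : (N:ℝ) * n ^ 2 * (-1) = -(N * n^2) := by ring
    rw [h3] at h
    exact h
  set c : ℕ → ℝ := fun n => Real.exp (α * (m + n + 1) ^ 2) with hcdef
  set K : ℝ := α * Real.exp (α * m ^ 2) with hK
  have hterm : ∀ n : ℕ, ENNReal.ofReal (c n) * volume {x | m + n ≤ |u x|} ≤
      ENNReal.ofReal (M * Real.exp (2 * α * (m + 1) ^ 2) * Real.exp (-1) ^ n) := by
    intro n
    have hf : volume {x | m + n ≤ |u x|} ≠ ⊤ := hfin _ (by positivity)
    rw [← ENNReal.ofReal_toReal hf, ← ENNReal.ofReal_mul (Real.exp_pos _).le]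
    apply ENNReal.ofReal_le_ofReal
    calc c n * (volume {x | m + n ≤ |u x|}).toReal ≤ c n * (M * Real.exp (-(N * n ^ 2))) := by
          have h1 := hdecay n
          have h2 : 0 < c n := Real.exp_pos _
          exact mul_le_mul_of_nonneg_left h1 h2.le
      _ = M * Real.exp (α * (m + n + 1) ^ 2 + -(N * n ^ 2)) := by
          rw [Real.exp_add]; ring
      _ ≤ M * Real.exp (2 * α * (m + 1) ^ 2 + n * (-1)) := by
          refine mul_le_mul_of_nonneg_left (Real.exp_le_exp.2 ?_) hM0
          have h1 : (n:ℝ) ≤ n ^ 2 := by exact_mod_cast Nat.le_self_pow (by norm_num) n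
          nlinarith [mul_nonneg hα.le (sq_nonneg (m + 1 - n)),
            mul_nonneg (sub_nonneg.2 hN) (sq_nonneg (n:ℝ))]
      _ = _ := by rw [Real.exp_add, Real.exp_nat_mul]; ring
  have hpt : ∀ x, ‖Real.exp (α * u x ^ 2) - 1‖ₑ ≤ ENNReal.ofReal K * ‖u x ^ 2‖ₑ +
      ∑' n : ℕ, {x | m + n ≤ |u x|}.indicator (fun _ => ENNReal.ofReal (c n)) x := by
    intro x
    have h0 : 0 ≤ α * u x ^ 2 := by positivity
    have h1 : 0 ≤ Real.exp (α * u x ^ 2) - 1 := by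
      have := Real.add_one_le_exp (α * u x ^ 2)
      linarith
    rw [Real.enorm_eq_ofReal h1]
    by_cases hx : |u x| < m
    · refine le_trans ?_ le_self_add
      rw [Real.enorm_eq_ofReal (by positivity), ← ENNReal.ofReal_mul (by positivity)]
      apply ENNReal.ofReal_le_ofReal
      have h2 : u x ^ 2 ≤ m ^ 2 := by
        rw [← sq_abs]
        gcongr
      have h3 := Real.add_one_le_exp (-(α * u x ^ 2))
      have h4 : Real.exp (α * u x ^ 2) * Real.exp (-(α * u x ^ 2)) = 1 := by
        rw [← Real.exp_add]; simp
      have h5 : Real.exp (α * u x ^ 2) ≤ Real.exp (α * m ^ 2) := by gcongr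
      have h6 := Real.exp_pos (α * u x ^ 2)
      have h7 : Real.exp (α * u x ^ 2) - 1 ≤ (α * u x ^ 2) * Real.exp (α * u x ^ 2) := by
        nlinarith
      refine h7.trans ?_
      rw [hK]
      calc _ ≤ (α * u x ^ 2) * Real.exp (α * m ^ 2) := by gcongr
        _ = _ := by ring
    · refine le_trans ?_ le_add_self
      push Not at hx
      set n := ⌊|u x| - m⌋₊ with hn
      have hn1 : (n:ℝ) ≤ |u x| - m := Nat.floor_le (by linarith)
      have hn2 : |u x| - m < n + 1 := Nat.lt_floor_add_one _
      refine le_trans ?_ (ENNReal.le_tsum n)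
      rw [Set.indicator_of_mem (by show m + n ≤ |u x|; linarith)]
      apply ENNReal.ofReal_le_ofReal
      have h2 : u x ^ 2 ≤ (m + n + 1) ^ 2 := by
        rw [← sq_abs]
        gcongr
        linarith
      have h5 : Real.exp (α * u x ^ 2) ≤ c n := by
        rw [hcdef]
        simp only
        gcongr
      linarith
  refine ⟨by fun_prop, ?_⟩
  refine lt_of_le_of_lt (lintegral_mono hpt) ?_
  rw [lintegral_add_left (by fun_prop), lintegral_const_mul _ (by fun_prop),
    lintegral_tsum (fun n => (measurable_const.indicator (hSm _)).aemeasurable)]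
  refine ENNReal.add_lt_top.2 ⟨ENNReal.mul_lt_top ENNReal.ofReal_lt_top hL2.2, ?_⟩
  have : ∀ n : ℕ, ∫⁻ x in strip, {x | m + n ≤ |u x|}.indicator (fun _ => ENNReal.ofReal (c n)) x ≤
      ENNReal.ofReal (M * Real.exp (2 * α * (m + 1) ^ 2) * Real.exp (-1) ^ n) := by
    intro n
    rw [lintegral_indicator (hSm _), lintegral_const, Measure.restrict_apply_univ,
      hres _ (by positivity)]
    exact hterm n
  refine lt_of_le_of_lt (ENNReal.tsum_le_tsum this) ?_
  rw [← ENNReal.ofReal_tsum_of_nonneg (fun n => by positivity)]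
  · exact ENNReal.ofReal_lt_top
  · exact (summable_geometric_of_lt_one (Real.exp_pos _).le (by simp)).mul_left _
end
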